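/- Let s be a weak composition and T ≺ Z in s-weak order. Let (a_1,b_1), …, (a_l,b_l) be the tree ascents of T such that (b_i,a_i) lies in inv(Z) − inv(T). Then the order complex Δ(T,Z) of the open interval (T,Z) is homotopy equivalent to a sphere if and only if inv(Z) = (inv(T) + A_T(a_1,b_1) + ⋯ + A_T(a_l,b_l))^tc, and in that case it is homotopy equivalent to a sphere of dimension l − 2. -/

import Mathlib

open scoped Classical

/-- An `s`-decreasing tree with internal vertices `1,…,n` (the root is `n`), encoded by
recording, for each non-root internal vertex `v`, its parent `parent v` (an internal vertex
with a larger label, so that labels decrease away from the root) and the index `idx v` of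
the child slot of `parent v` (among `0,…,s (parent v)`, left to right) containing `v`.
Distinct internal vertices occupy distinct child slots; all remaining slots are leaves. -/
structure SDecTree (n : ℕ) (s : ℕ → ℕ) where
  parent : ℕ → ℕ
  idx : ℕ → ℕ
  parent_gt : ∀ v, 1 ≤ v → v < n → v < parent v
  parent_le : ∀ v, 1 ≤ v → v < n → parent v ≤ n
  idx_le : ∀ v, 1 ≤ v → v < n → idx v ≤ s (parent v)
  slot_inj : ∀ v w, 1 ≤ v → v < n → 1 ≤ w → w < n →
      parent v = parent w → idx v = idx w → v = w
  parent_out : ∀ v, v = 0 ∨ n ≤ v → parent v = 0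
  idx_out : ∀ v, v = 0 ∨ n ≤ v → idx v = 0

namespace SDecTree

variable {n : ℕ} {s : ℕ → ℕ}

/-- `y` is a weak ancestor of `x`, i.e. `x` is a labeled vertex of the subtree `T^y`. -/
def Descend (T : SDecTree n s) (x y : ℕ) : Prop :=
  ∃ k, T.parent^[k] x = y ∧ ∀ m ≤ k, 1 ≤ T.parent^[m] x ∧ T.parent^[m] x ≤ n

/-- `x` is a labeled vertex of the subtree `T^y_j` rooted at the `j`-th child of `y`. -/
def InSub (T : SDecTree n s) (y j x : ℕ) : Prop :=
  ∃ c, T.Descend x c ∧ T.parent c = y ∧ T.idx c = j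

/-- `x` lies strictly left of `y` in the planar tree `T`. -/
def LeftOf (T : SDecTree n s) (x y : ℕ) : Prop :=
  ∃ z j₁ j₂, j₁ < j₂ ∧ T.InSub z j₁ x ∧ T.InSub z j₂ y

/-- The cardinality `#_T(y,x)` of the pair `(y,x)`: it is `j` if `x ∈ T^y_j`
(so `0` if `x ∈ T^y_0` and `s y` if `x ∈ T^y_{s y}`), `0` if `x` is left of `y`, and
`s y` if `x` is right of `y`; it is `0` for out-of-range pairs. -/
noncomputable def card (T : SDecTree n s) (y x : ℕ) : ℕ :=
  if h : ∃ j, T.InSub y j x then h.choose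
  else if 1 ≤ x ∧ x < y ∧ y ≤ n ∧ ¬ T.LeftOf x y then s y else 0

/-- `x` is a labeled vertex of `T^a ∖ 0`, i.e. of `T^a` with `T^a_0` replaced by a leaf. -/
def InSubMinus0 (T : SDecTree n s) (a x : ℕ) : Prop :=
  x = a ∨ ∃ j, 0 < j ∧ T.InSub a j x

/-- `(a,b)` is a tree ascent of `T`. -/
def TreeAscent (T : SDecTree n s) (a b : ℕ) : Prop :=
  1 ≤ a ∧ a < b ∧ b ≤ n ∧
  (∃ i, i < s b ∧ T.InSub b i a) ∧
  (∀ e j, a < e → e < b → T.InSub e j a → j = s e) ∧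
  (0 < s a → ∀ x, ¬ T.InSub a (s a) x)

end SDecTree

/-- A multi-inversion set (encoded by its multiplicity function) is transitive:
if `a < b < c` then `#(b,a) = 0` or `#(c,a) ≥ #(c,b)`. -/
def IsTransitiveInv (I : ℕ → ℕ → ℕ) : Prop :=
  ∀ a b c, a < b → b < c → I b a = 0 ∨ I c b ≤ I c a

/-- The transitive closure of a multi-inversion set: the smallest (by inclusion, i.e.
pointwise on multiplicities) transitive multi-inversion set containing it. -/
noncomputable def tcInv (I : ℕ → ℕ → ℕ) : ℕ → ℕ → ℕ := fun y x =>
  sInf {m | ∃ J : ℕ → ℕ → ℕ, IsTransitiveInv J ∧ (∀ y' x', I y' x' ≤ J y' x') ∧ J y x = m}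

/-- Add one copy of the inversion `(b,a)` to `I`, capping the multiplicity at `s b`. -/
def addInv (s : ℕ → ℕ) (I : ℕ → ℕ → ℕ) (b a : ℕ) : ℕ → ℕ → ℕ := fun y x =>
  if y = b ∧ x = a then min (I y x + 1) (s y) else I y x

namespace SDecTree

variable {n : ℕ} {s : ℕ → ℕ}

/-- The `s`-weak order: `T ⪯ Z` iff `#_T(y,x) ≤ #_Z(y,x)` for all pairs. -/
def wle (T Z : SDecTree n s) : Prop := ∀ y x, T.card y x ≤ Z.card y x

/-- Strict `s`-weak order. -/
def wlt (T Z : SDecTree n s) : Prop := wle T Z ∧ ¬ wle Z T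

/-- Cover relation in the `s`-weak order. -/
def wcov (T Z : SDecTree n s) : Prop := wlt T Z ∧ ∀ U, wlt T U → wlt U Z → False

/-- `W` is the join of `T` and `Z` in the `s`-weak order. -/
def IsJoin (T Z W : SDecTree n s) : Prop :=
  wle T W ∧ wle Z W ∧ ∀ U, wle T U → wle Z U → wle W U

/-- `Z` is the `s`-tree rotation of `T` along the tree ascent `(a,b)`, i.e.
`inv Z = (inv T + (b,a))^tc`. -/
def IsRotation (T Z : SDecTree n s) (a b : ℕ) : Prop :=
  T.TreeAscent a b ∧
  ∀ y x, 1 ≤ x → x < y → y ≤ n → Z.card y x = tcInv (addInv s T.card b a) y x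

/-- The set `A_T(a,b)` of inversions added by a rotation producing `Z`: the pairs `(f,e)`
with `#_Z(f,e) > #_T(f,e)`. -/
def Aset (T Z : SDecTree n s) : Set (ℕ × ℕ) :=
  {p | T.card p.1 p.2 < Z.card p.1 p.2}

/-- The set `A_T(a,b)` described directly via the transitive closure. -/
def ARot (T : SDecTree n s) (a b : ℕ) : Set (ℕ × ℕ) :=
  {p | T.card p.1 p.2 < tcInv (addInv s T.card b a) p.1 p.2}

/-- The set `F_T(a,c)` (here `b` and `d` are the partners of `a` and `c` in the
respective tree ascents `(a,b)` and `(c,d)`): it is `{(d,e) : e ∈ T^a∖0}` if `b = c`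
and `a ∈ T^c_0`, and empty otherwise. -/
def Fset (T : SDecTree n s) (a b c d : ℕ) : Set (ℕ × ℕ) :=
  {p | b = c ∧ T.InSub c 0 a ∧ p.1 = d ∧ T.InSubMinus0 a p.2}

/-- `T` is an `s`-Tamari tree: `#_T(c,a) ≤ #_T(c,b)` whenever `a < b < c`. -/
def IsTamari (T : SDecTree n s) : Prop :=
  ∀ a b c, a < b → b < c → T.card c a ≤ T.card c b

/-- `(a,b)` is a Tamari tree ascent of `T`: `a` is a non-rightmost child of `b`. -/
def TamariAscent (T : SDecTree n s) (a b : ℕ) : Prop :=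
  1 ≤ a ∧ a < n ∧ T.parent a = b ∧ T.card b a < s b

/-- `Z` is the `s`-Tamari rotation of `T` along the Tamari tree ascent `(a,b)`. -/
def IsTamRotation (T Z : SDecTree n s) (a b : ℕ) : Prop :=
  T.TamariAscent a b ∧
  ∀ y x, 1 ≤ x → x < y → y ≤ n → Z.card y x = tcInv (addInv s T.card b a) y x

/-- Cover relation in the `s`-Tamari lattice. -/
def tamcov (T Z : SDecTree n s) : Prop :=
  IsTamari T ∧ IsTamari Z ∧ wlt T Z ∧ ∀ U, IsTamari U → wlt T U → wlt U Z → False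

/-- `W` is the join of `T` and `Z` in the `s`-Tamari lattice. -/
def IsTamJoin (T Z W : SDecTree n s) : Prop :=
  IsTamari W ∧ wle T W ∧ wle Z W ∧ ∀ U, IsTamari U → wle T U → wle Z U → wle W U

/-- The open interval `(T,Z)` in the `s`-weak order. -/
def OpenInterval (T Z : SDecTree n s) : Set (SDecTree n s) := {U | wlt T U ∧ wlt U Z}

/-- A set of trees forming a chain in the `s`-weak order. -/
def IsChainSet (C : Set (SDecTree n s)) : Prop :=
  C.Pairwise fun U V => wlt U V ∨ wlt V U

/-- The geometric realization of the order complex `Δ(T,Z)` of the open interval `(T,Z)`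
in the `s`-weak order: the space of finitely supported probability vectors on the vertex
set whose support is a chain of the open interval. -/
def orderComplex (T Z : SDecTree n s) : Set (SDecTree n s → ℝ) :=
  {f | (∀ U, 0 ≤ f U) ∧ (Function.support f).Finite ∧
    Function.support f ⊆ OpenInterval T Z ∧ IsChainSet (Function.support f) ∧
    ∑ᶠ U, f U = 1}

/-- The geometric realization of the order complex of the open interval `(T,Z)` in the
`s`-Tamari lattice. -/
def tamOrderComplex (T Z : SDecTree n s) : Set (SDecTree n s → ℝ) :=
  {f | (∀ U, 0 ≤ f U) ∧ (Function.support f).Finite ∧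
    Function.support f ⊆ {U | IsTamari U ∧ wlt T U ∧ wlt U Z} ∧
    IsChainSet (Function.support f) ∧ ∑ᶠ U, f U = 1}

end SDecTree

/-- The list of labels of the consecutive cover relations along a saturated chain,
recorded as a list of poset elements. -/
def labelsOf {α : Type*} (lab : α → α → ℕ) (L : List α) : List ℕ :=
  (L.zip L.tail).map fun p => lab p.1 p.2

/-- The multi-inversion set `inv T + A_T(a₁,b₁) + ⋯ + A_T(a_l,b_l)`, summed over all the
tree ascents `(aᵢ,bᵢ)` of `T` with `(bᵢ,aᵢ) ∈ inv Z − inv T`; each `A` set contributes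
multiplicity one at each of its members, and sums are capped at `s y`. -/
noncomputable def ascSum (n : ℕ) (s : ℕ → ℕ) (T Z : SDecTree n s) : ℕ → ℕ → ℕ :=
  fun y x =>
    min (T.card y x +
      {p : ℕ × ℕ | T.TreeAscent p.1 p.2 ∧ T.card p.2 p.1 < Z.card p.2 p.1 ∧
        (y, x) ∈ SDecTree.ARot T p.1 p.2}.ncard)
      (s y)


namespace SDecTree

variable {n : ℕ} {s : ℕ → ℕ}

theorem descend_iff (T : SDecTree n s) {x y : ℕ} :
    T.Descend x y ↔ 1 ≤ x ∧ x ≤ n ∧ (x = y ∨ T.Descend (T.parent x) y) := by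
  constructor
  · rintro ⟨k, hk, hm⟩
    have h0 := hm 0 (Nat.zero_le _)
    refine ⟨h0.1, h0.2, ?_⟩
    cases k with
    | zero => left; simpa using hk
    | succ k =>
      right
      refine ⟨k, by simpa using hk, fun m hmk => ?_⟩
      simpa using hm (m + 1) (by omega)
  · rintro ⟨h1, h2, h3⟩
    rcases h3 with rfl | ⟨k, hk, hm⟩
    · exact ⟨0, rfl, fun m hm => by
        obtain rfl : m = 0 := by omega
        exact ⟨h1, h2⟩⟩
    · refine ⟨k + 1, by simpa using hk, fun m hmk => ?_⟩
      cases m with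
      | zero => exact ⟨h1, h2⟩
      | succ m => simpa using hm m (by omega)

theorem Descend.pos {T : SDecTree n s} {x y : ℕ} (h : T.Descend x y) : 1 ≤ x :=
  (T.descend_iff.1 h).1

theorem Descend.le_n {T : SDecTree n s} {x y : ℕ} (h : T.Descend x y) : x ≤ n :=
  (T.descend_iff.1 h).2.1

theorem Descend.refl (T : SDecTree n s) {x : ℕ} (h1 : 1 ≤ x) (h2 : x ≤ n) : T.Descend x x :=
  T.descend_iff.2 ⟨h1, h2, Or.inl rfl⟩

theorem Descend.lt_n_of_parent {T : SDecTree n s} {x y : ℕ} (h : T.Descend (T.parent x) y) :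
    1 ≤ x ∧ x < n := by
  by_contra hc
  have := T.parent_out x (by omega)
  have := h.pos
  omega

theorem Descend.induct {T : SDecTree n s} {y : ℕ} {P : ℕ → Prop}
    (h0 : 1 ≤ y → y ≤ n → P y)
    (h1 : ∀ x, 1 ≤ x → x < n → T.Descend (T.parent x) y → P (T.parent x) → P x) :
    ∀ x, T.Descend x y → P x := by
  have key : ∀ m x, n - x = m → T.Descend x y → P x := by
    intro m
    induction m using Nat.strong_induction_on with
    | _ m ih =>
      intro x hx hd
      obtain ⟨hp, hn, rfl | h⟩ := T.descend_iff.1 hd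
      · exact h0 hp hn
      · have hr := h.lt_n_of_parent
        have := T.parent_gt x hr.1 hr.2
        exact h1 x hr.1 hr.2 h (ih (n - T.parent x) (by omega) _ rfl h)
  exact fun x h => key _ x rfl h

theorem Descend.le {T : SDecTree n s} {x y : ℕ} (h : T.Descend x y) : x ≤ y := by
  refine Descend.induct (P := fun x => x ≤ y) (fun _ _ => le_rfl) ?_ x h
  intro x h1 h2 _ h3
  have := T.parent_gt x h1 h2
  omega

theorem Descend.le_n' {T : SDecTree n s} {x y : ℕ} (h : T.Descend x y) : y ≤ n := by
  refine Descend.induct (P := fun x => y ≤ n) (fun _ h => h) ?_ x h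
  intro x h1 h2 _ h3
  exact h3

theorem Descend.trans {T : SDecTree n s} {x y z : ℕ} (h : T.Descend x y) (h' : T.Descend y z) :
    T.Descend x z := by
  refine Descend.induct (P := fun x => T.Descend x z) (fun _ _ => h') ?_ x h
  intro x h1 h2 _ h3
  exact T.descend_iff.2 ⟨h1, h2.le, Or.inr h3⟩

theorem Descend.root (T : SDecTree n s) {x : ℕ} (h1 : 1 ≤ x) (h2 : x ≤ n) : T.Descend x n := by
  have key : ∀ m x, n - x = m → 1 ≤ x → x ≤ n → T.Descend x n := by
    intro m
    induction m using Nat.strong_induction_on with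
    | _ m ih =>
      intro x hx h1 h2
      by_cases hn : x = n
      · exact T.descend_iff.2 ⟨h1, h2, Or.inl hn⟩
      · have h3 := T.parent_gt x h1 (by omega)
        have h4 := T.parent_le x h1 (by omega)
        exact T.descend_iff.2 ⟨h1, h2, Or.inr (ih (n - T.parent x) (by omega) _ rfl (by omega) h4)⟩
  exact key _ x rfl h1 h2

theorem Descend.comparable {T : SDecTree n s} {x y z : ℕ} (h : T.Descend x y)
    (h' : T.Descend x z) : T.Descend y z ∨ T.Descend z y := by
  revert h'
  refine Descend.induct (P := fun x => T.Descend x z → T.Descend y z ∨ T.Descend z y)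
    (fun _ _ h => Or.inl h) ?_ x h
  intro x h1 h2 h3 h4 h5
  obtain ⟨_, _, rfl | h6⟩ := T.descend_iff.1 h5
  · right
    exact T.descend_iff.2 ⟨h1, h2.le, Or.inr h3⟩
  · exact h4 h6

theorem Descend.cases {T : SDecTree n s} {x y : ℕ} (h : T.Descend x y) :
    x = y ∨ ∃ j, T.InSub y j x := by
  refine Descend.induct (P := fun x => x = y ∨ ∃ j, T.InSub y j x) (fun _ _ => Or.inl rfl) ?_ x h
  intro x h1 h2 h3 h4
  right
  rcases h4 with h4 | ⟨j, c, hc, h5, h6⟩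
  · exact ⟨T.idx x, x, Descend.refl T h1 h2.le, h4, rfl⟩
  · exact ⟨j, c, T.descend_iff.2 ⟨h1, h2.le, Or.inr hc⟩, h5, h6⟩

theorem InSub.of_descend {T : SDecTree n s} {x x' y j : ℕ} (h : T.InSub y j x')
    (hd : T.Descend x x') : T.InSub y j x := by
  obtain ⟨c, h1, h2, h3⟩ := h
  exact ⟨c, hd.trans h1, h2, h3⟩

theorem InSub.zero {T : SDecTree n s} {x j : ℕ} (h : T.InSub 0 j x) : j = 0 := by
  obtain ⟨c, h1, h2, h3⟩ := h
  by_cases hc : 1 ≤ c ∧ c < n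
  · have := T.parent_gt c hc.1 hc.2
    omega
  · rw [← h3]; exact T.idx_out c (by omega)

theorem InSub.descend {T : SDecTree n s} {x y j : ℕ} (hy : 1 ≤ y) (h : T.InSub y j x) :
    T.Descend x y ∧ x < y ∧ j ≤ s y := by
  obtain ⟨c, h1, h2, h3⟩ := h
  have hc : 1 ≤ c ∧ c < n := by
    by_contra hc
    have := T.parent_out c (by omega)
    omega
  have h4 := T.parent_gt c hc.1 hc.2
  have h5 := T.parent_le c hc.1 hc.2
  have h6 := T.idx_le c hc.1 hc.2
  have h7 := h1.le
  subst h2 h3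
  refine ⟨h1.trans (T.descend_iff.2 ⟨hc.1, hc.2.le, Or.inr (Descend.refl T hy h5)⟩), by omega, h6⟩

theorem InSub.child_unique {T : SDecTree n s} {x y c c' : ℕ}
    (h1 : T.Descend x c) (h2 : T.parent c = y) (h1' : T.Descend x c') (h2' : T.parent c' = y) :
    c = c' := by
  have aux : ∀ c c', T.parent c = y → T.parent c' = y → T.Descend c c' → c = c' := by
    intro c c' h2 h2' h
    obtain ⟨_, _, rfl | h6⟩ := T.descend_iff.1 h
    · rfl
    · exfalso
      rw [h2] at h6
      have h7 := h6.le
      have h8 := h6.pos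
      have hc : 1 ≤ c' ∧ c' < n := by
        by_contra hc
        have := T.parent_out c' (by omega)
        omega
      have := T.parent_gt c' hc.1 hc.2
      omega
  rcases h1.comparable h1' with h | h
  · exact aux _ _ h2 h2' h
  · exact (aux _ _ h2' h2 h).symm

theorem InSub.unique {T : SDecTree n s} {x y j j' : ℕ} (h : T.InSub y j x)
    (h' : T.InSub y j' x) : j = j' := by
  obtain ⟨c, h1, h2, h3⟩ := h
  obtain ⟨c', h1', h2', h3'⟩ := h'
  obtain rfl := InSub.child_unique h1 h2 h1' h2'
  omega

theorem LeftOf.exists_pos {T : SDecTree n s} {x y : ℕ} (h : T.LeftOf x y) :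
    ∃ z j₁ j₂, 1 ≤ z ∧ j₁ < j₂ ∧ T.InSub z j₁ x ∧ T.InSub z j₂ y := by
  obtain ⟨z, j₁, j₂, h1, h2, h3⟩ := h
  refine ⟨z, j₁, j₂, ?_, h1, h2, h3⟩
  by_contra hz
  obtain rfl : z = 0 := by omega
  have := h2.zero
  have := h3.zero
  omega

theorem tri (T : SDecTree n s) {x y : ℕ} (hx : 1 ≤ x) (hx' : x ≤ n) (hy : 1 ≤ y) (hy' : y ≤ n) :
    T.Descend x y ∨ T.Descend y x ∨ T.LeftOf x y ∨ T.LeftOf y x := by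
  have hex : ∃ z, T.Descend x z ∧ T.Descend y z :=
    ⟨n, Descend.root T hx hx', Descend.root T hy hy'⟩
  obtain ⟨hz1, hz2⟩ := Nat.find_spec hex
  have hmin := fun m => Nat.find_min hex (m := m)
  set z := Nat.find hex
  rcases hz1.cases with h | ⟨j1, c1, h1, h2, h3⟩
  · right; left; rw [h]; exact hz2
  rcases hz2.cases with h | ⟨j2, c2, h4, h5, h6⟩
  · left; rw [h]; exact hz1
  rcases lt_trichotomy j1 j2 with h | h | h
  · exact Or.inr (Or.inr (Or.inl ⟨z, j1, j2, h, ⟨c1, h1, h2, h3⟩, ⟨c2, h4, h5, h6⟩⟩))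
  · exfalso
    have hzpos : 1 ≤ z := by have := hz1.le; omega
    have hc1 : 1 ≤ c1 ∧ c1 < n := by
      by_contra hc
      have := T.parent_out c1 (by omega)
      omega
    have hc2 : 1 ≤ c2 ∧ c2 < n := by
      by_contra hc
      have := T.parent_out c2 (by omega)
      omega
    have := T.slot_inj c1 c2 hc1.1 hc1.2 hc2.1 hc2.2 (by omega) (by omega)
    subst this
    have := T.parent_gt c1 hc1.1 hc1.2
    exact hmin c1 (by omega) ⟨h1, h4⟩
  · exact Or.inr (Or.inr (Or.inr ⟨z, j2, j1, h, ⟨c2, h4, h5, h6⟩, ⟨c1, h1, h2, h3⟩⟩))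

theorem LeftOf.desc {T : SDecTree n s} {x y x' y' : ℕ} (h : T.LeftOf x y)
    (hx : T.Descend x' x) (hy : T.Descend y' y) : T.LeftOf x' y' := by
  obtain ⟨z, j₁, j₂, h1, h2, h3⟩ := h
  exact ⟨z, j₁, j₂, h1, h2.of_descend hx, h3.of_descend hy⟩

theorem LeftOf.irrefl {T : SDecTree n s} {x : ℕ} (h : T.LeftOf x x) : False := by
  obtain ⟨z, j₁, j₂, h1, h2, h3⟩ := h
  have := h2.unique h3
  omega

theorem InSub.pos {T : SDecTree n s} {x y j : ℕ} (h : T.InSub y j x) : 1 ≤ x ∧ x ≤ n := by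
  obtain ⟨c, h1, _⟩ := h
  exact ⟨h1.pos, h1.le_n⟩

theorem LeftOf.pos {T : SDecTree n s} {x y : ℕ} (h : T.LeftOf x y) :
    (1 ≤ x ∧ x ≤ n) ∧ (1 ≤ y ∧ y ≤ n) := by
  obtain ⟨z, j₁, j₂, h1, h2, h3⟩ := h
  exact ⟨h2.pos, h3.pos⟩

theorem LeftOf.not_descend {T : SDecTree n s} {x y : ℕ} (h : T.LeftOf x y) :
    ¬ T.Descend x y := fun hd =>
  LeftOf.irrefl (h.desc (Descend.refl T h.pos.1.1 h.pos.1.2) hd)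

theorem LeftOf.not_descend' {T : SDecTree n s} {x y : ℕ} (h : T.LeftOf x y) :
    ¬ T.Descend y x := fun hd =>
  LeftOf.irrefl (h.desc hd (Descend.refl T h.pos.2.1 h.pos.2.2))

theorem LeftOf.trans {T : SDecTree n s} {x y w : ℕ} (h : T.LeftOf x y) (h' : T.LeftOf y w) :
    T.LeftOf x w := by
  obtain ⟨z, j₁, j₂, hz, h1, h2, h3⟩ := h.exists_pos
  obtain ⟨z', k₁, k₂, hz', h1', h2', h3'⟩ := h'.exists_pos
  have d1 := (h3.descend hz).1
  have d2 := (h2'.descend hz').1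
  rcases d1.comparable d2 with hd | hd
  · rcases hd.cases with rfl | ⟨k, hk⟩
    · have := h3.unique h2'
      exact ⟨z, j₁, k₂, by omega, h2, h3'⟩
    · have := (hk.of_descend d1).unique h2'
      subst this
      exact ⟨z', k, k₂, h1', hk.of_descend (h2.descend hz).1, h3'⟩
  · rcases hd.cases with rfl | ⟨k, hk⟩
    · have := h3.unique h2'
      exact ⟨z', j₁, k₂, by omega, h2, h3'⟩
    · have := (hk.of_descend d2).unique h3
      subst this
      exact ⟨z, j₁, k, h1, h2, hk.of_descend (h3'.descend hz').1⟩

theorem LeftOf.asymm {T : SDecTree n s} {x y : ℕ} (h : T.LeftOf x y) (h' : T.LeftOf y x) :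
    False := (h.trans h').irrefl

theorem card_inSub {T : SDecTree n s} {x y j : ℕ} (h : T.InSub y j x) : T.card y x = j := by
  have hex : ∃ j, T.InSub y j x := ⟨j, h⟩
  unfold card
  rw [dif_pos hex]
  exact hex.choose_spec.unique h

theorem card_left {T : SDecTree n s} {x y : ℕ} (h : T.LeftOf x y) : T.card y x = 0 := by
  unfold card
  rw [dif_neg, if_neg]
  · simp [h]
  · rintro ⟨j, hj⟩
    exact h.not_descend (hj.descend h.pos.2.1).1

theorem card_right {T : SDecTree n s} {x y : ℕ} (h : T.LeftOf y x) (hxy : x < y) :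
    T.card y x = s y := by
  unfold card
  rw [dif_neg, if_pos]
  · exact ⟨h.pos.2.1, hxy, h.pos.1.2, fun h' => h.asymm h'⟩
  · rintro ⟨j, hj⟩
    exact h.not_descend' (hj.descend h.pos.1.1).1

theorem card_out (T : SDecTree n s) {x y : ℕ} (h : ¬ (1 ≤ x ∧ x < y ∧ y ≤ n)) :
    T.card y x = 0 := by
  by_cases hex : ∃ j, T.InSub y j x
  · obtain ⟨j, hj⟩ := hex
    rw [card_inSub hj]
    rcases Nat.eq_zero_or_pos y with rfl | hy
    · exact hj.zero
    · exfalso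
      have h0 := hj.descend hy
      have h1 := h0.1.pos
      have h2 := h0.1.le_n'
      omega
  · unfold card
    rw [dif_neg hex, if_neg]
    tauto

/-- the position of `x` with respect to a larger vertex `y` -/
theorem tri_lt (T : SDecTree n s) {x y : ℕ} (hx : 1 ≤ x) (hxy : x < y) (hy : y ≤ n) :
    (T.InSub y (T.card y x) x) ∨ T.LeftOf x y ∨ T.LeftOf y x := by
  rcases T.tri hx (by omega) (by omega) hy with h | h | h | h
  · rcases h.cases with h | ⟨j, hj⟩
    · omega
    · left; rw [card_inSub hj]; exact hj
  · have := h.le; omega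
  · exact Or.inr (Or.inl h)
  · exact Or.inr (Or.inr h)

theorem card_le (T : SDecTree n s) (y x : ℕ) : T.card y x ≤ s y := by
  by_cases h : 1 ≤ x ∧ x < y ∧ y ≤ n
  · rcases T.tri_lt h.1 h.2.1 h.2.2 with h1 | h1 | h1
    · exact (h1.descend (by omega)).2.2
    · rw [card_left h1]; omega
    · rw [card_right h1 h.2.1]
  · rw [T.card_out h]; omega

theorem card_desc {T : SDecTree n s} {u v c : ℕ} (h : T.Descend u v) (hv : v < c) (hc : c ≤ n) :
    T.card c u = T.card c v := by
  have h1 := h.le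
  have h0 := h.pos
  rcases T.tri_lt (x := v) (y := c) (by omega) hv hc with h2 | h2 | h2
  · exact card_inSub (h2.of_descend h)
  · rw [card_left h2, card_left (h2.desc h (Descend.refl T (by omega) hc))]
  · rw [card_right h2 hv, card_right (h2.desc (Descend.refl T (by omega) hc) h) (by omega)]

theorem card_mono {T : SDecTree n s} {u v c : ℕ} (h : T.LeftOf u v) (hu : u < c) (hv : v < c)
    (hc : c ≤ n) : T.card c u ≤ T.card c v := by
  obtain ⟨⟨hu1, hu2⟩, hv1, hv2⟩ := h.pos
  have hcc := Descend.refl T (x := c) (by omega) hc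
  rcases T.tri_lt (x := v) (y := c) hv1 hv hc with h2 | h2 | h2
  · rcases T.tri_lt (x := u) (y := c) hu1 hu hc with h3 | h3 | h3
    · obtain ⟨z, j₁, j₂, hz, k1, k2, k3⟩ := h.exists_pos
      have d1 := (h2.descend (by omega)).1
      have d2 := (k3.descend hz).1
      have d3 := (h3.descend (by omega)).1
      rcases d1.comparable d2 with hd | hd
      · rcases hd.cases with rfl | ⟨k, hk⟩
        · have := h2.unique k3
          have := h3.unique k2
          omega
        · have := (hk.of_descend d1).unique k3
          have := (hk.of_descend d3).unique k2
          omega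
      · rcases hd.cases with rfl | ⟨k, hk⟩
        · have := h2.unique k3
          have := h3.unique k2
          omega
        · have := (hk.of_descend d2).unique h2
          have := (hk.of_descend (k2.descend hz).1).unique h3
          omega
    · rw [card_left h3]; omega
    · exact (h.asymm (h3.desc (h2.descend (by omega)).1 (Descend.refl T hu1 hu2))).elim
  · rw [card_left (h.trans h2)]; omega
  · rw [card_right h2 hv]; exact card_le _ _ _

end SDecTree

/-- A tree-inversion set: transitive, planar, bounded by `s`, supported on valid pairs. -/
structure IsTreeInv (n : ℕ) (s : ℕ → ℕ) (I : ℕ → ℕ → ℕ) : Prop where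
  trans : IsTransitiveInv I
  plan : ∀ a b c, 1 ≤ a → a < b → b < c → c ≤ n → I b a = s b ∨ I c a ≤ I c b
  le : ∀ y x, I y x ≤ s y
  out : ∀ y x, ¬ (1 ≤ x ∧ x < y ∧ y ≤ n) → I y x = 0

namespace SDecTree

variable {n : ℕ} {s : ℕ → ℕ}

theorem isTreeInv_card (T : SDecTree n s) : IsTreeInv n s T.card where
  trans := by
    intro a b c hab hbc
    by_cases h : 1 ≤ a ∧ c ≤ n
    · rcases T.tri_lt (x := a) (y := b) h.1 hab (by omega) with h2 | h2 | h2
      · right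
        rw [card_desc (h2.descend (by omega)).1 hbc h.2]
      · left; exact card_left h2
      · right; exact card_mono h2 hbc (by omega) h.2
    · by_cases h1 : 1 ≤ a
      · right
        rw [T.card_out (x := b) (y := c) (by omega)]
        omega
      · left
        exact T.card_out (by omega)
  plan := by
    intro a b c ha hab hbc hc
    rcases T.tri_lt (x := a) (y := b) ha hab (by omega) with h2 | h2 | h2
    · right
      rw [card_desc (h2.descend (by omega)).1 hbc hc]
    · right; exact card_mono h2 (by omega) hbc hc
    · left; exact card_right h2 hab
  le := T.card_le
  out := fun y x h => T.card_out h

theorem descend_iff_card (T : SDecTree n s) {x y : ℕ} (hx : 1 ≤ x) (hxy : x ≤ y) (hy : y ≤ n) :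
    T.Descend x y ↔ ∀ c, y < c → c ≤ n → T.card c x = T.card c y := by
  constructor
  · intro h c h1 h2
    exact card_desc h h1 h2
  · intro h
    rcases Nat.lt_or_ge x y with hlt | hge
    · rcases T.tri_lt hx hlt hy with h2 | h2 | h2
      · exact (h2.descend (by omega)).1
      · exfalso
        obtain ⟨z, j₁, j₂, hz, k1, k2, k3⟩ := h2.exists_pos
        have := h z (k3.descend hz).2.1 (k3.descend hz).1.le_n'
        rw [card_inSub k2, card_inSub k3] at this
        omega
      · exfalso
        obtain ⟨z, j₁, j₂, hz, k1, k2, k3⟩ := h2.exists_pos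
        have := h z (k2.descend hz).2.1 (k2.descend hz).1.le_n'
        rw [card_inSub k2, card_inSub k3] at this
        omega
    · obtain rfl : x = y := by omega
      exact Descend.refl T hx hy

theorem descend_parent (T : SDecTree n s) {v : ℕ} (h1 : 1 ≤ v) (h2 : v < n) :
    T.Descend v (T.parent v) := by
  have h3 := T.parent_gt v h1 h2
  have h4 := T.parent_le v h1 h2
  exact T.descend_iff.2 ⟨h1, h2.le, Or.inr (Descend.refl T (by omega) h4)⟩

theorem ext_card {T Z : SDecTree n s} (h : ∀ y x, T.card y x = Z.card y x) : T = Z := by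
  have hle : ∀ (T Z : SDecTree n s), (∀ y x, T.card y x = Z.card y x) → ∀ v, 1 ≤ v → v < n →
      Z.parent v ≤ T.parent v := by
    intro T Z h v h1 h2
    have h3 := T.parent_gt v h1 h2
    have h4 := T.parent_le v h1 h2
    have h5 := T.descend_parent h1 h2
    rw [T.descend_iff_card h1 h3.le h4] at h5
    have h6 : Z.Descend v (T.parent v) := by
      rw [Z.descend_iff_card h1 h3.le h4]
      simpa only [h] using h5
    obtain ⟨_, _, h7 | h7⟩ := Z.descend_iff.1 h6
    · omega
    · exact h7.le
  have hpar : T.parent = Z.parent := by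
    funext v
    by_cases hv : 1 ≤ v ∧ v < n
    · exact le_antisymm (hle Z T (fun y x => (h y x).symm) v hv.1 hv.2) (hle T Z h v hv.1 hv.2)
    · rw [T.parent_out v (by omega), Z.parent_out v (by omega)]
  have hidx : T.idx = Z.idx := by
    funext v
    by_cases hv : 1 ≤ v ∧ v < n
    · have a1 : T.card (T.parent v) v = T.idx v :=
        card_inSub ⟨v, Descend.refl T hv.1 hv.2.le, rfl, rfl⟩
      have a2 : Z.card (Z.parent v) v = Z.idx v :=
        card_inSub ⟨v, Descend.refl Z hv.1 hv.2.le, rfl, rfl⟩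
      rw [← a1, ← a2, h, hpar]
    · rw [T.idx_out v (by omega), Z.idx_out v (by omega)]
  cases T
  cases Z
  simp only [mk.injEq]
  exact ⟨hpar, hidx⟩

end SDecTree

namespace IsTreeInv

variable {n : ℕ} {s : ℕ → ℕ} {I : ℕ → ℕ → ℕ}

/-- descendant relation read off from the inversion set -/
def Desc (n : ℕ) (I : ℕ → ℕ → ℕ) (a b : ℕ) : Prop :=
  ∀ c, b < c → c ≤ n → I c a = I c b

/-- parent read off from the inversion set -/
noncomputable def par (n : ℕ) (I : ℕ → ℕ → ℕ) (a : ℕ) : ℕ :=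
  if 1 ≤ a ∧ a < n then sInf {b | a < b ∧ b ≤ n ∧ Desc n I a b} else 0

theorem par_spec (I : ℕ → ℕ → ℕ) {a : ℕ} (h : 1 ≤ a ∧ a < n) :
    a < par n I a ∧ par n I a ≤ n ∧ Desc n I a (par n I a) := by
  unfold par
  rw [if_pos h]
  exact Nat.sInf_mem (s := {b | a < b ∧ b ≤ n ∧ Desc n I a b})
    ⟨n, h.2, le_rfl, fun c h1 h2 => by omega⟩

theorem par_le (I : ℕ → ℕ → ℕ) {a b : ℕ} (h : 1 ≤ a) (hab : a < b) (hb : b ≤ n)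
    (hd : Desc n I a b) : par n I a ≤ b := by
  unfold par
  rw [if_pos (by omega)]
  exact Nat.sInf_le ⟨hab, hb, hd⟩

theorem slot_aux (h : IsTreeInv n s I) {v w : ℕ} (hv : 1 ≤ v) (hvw : v < w) (hw : w < n)
    (hp : par n I v = par n I w) (hi : I (par n I v) v = I (par n I w) w) : False := by
  obtain ⟨a1, a2, a3⟩ := par_spec I (n := n) (a := v) (by omega)
  obtain ⟨b1, b2, b3⟩ := par_spec I (n := n) (a := w) (by omega)
  rw [hp] at a1 a2 a3 hi
  set b := par n I w with hb
  have hnd : ¬ Desc n I v w := fun hd => by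
    have := par_le I hv hvw hw.le hd
    omega
  unfold Desc at hnd
  push Not at hnd
  obtain ⟨c0, hc0, hc0', hne⟩ := hnd
  have hbig : ∀ c, b ≤ c → c ≤ n → I c v = I c w := by
    intro c h1 h2
    rcases Nat.lt_or_ge b c with h3 | h3
    · rw [a3 c h3 h2, b3 c h3 h2]
    · obtain rfl : c = b := by omega
      exact hi
  obtain ⟨c, ⟨hc, hc', hne'⟩, hmax⟩ : ∃ c, (w < c ∧ c < b ∧ I c v ≠ I c w) ∧
      ∀ d, c < d → d ≤ n → I d v = I d w := by
    have hex : ∃ m, ∃ c, n - c = m ∧ c ≤ n ∧ w < c ∧ I c v ≠ I c w := ⟨_, c0, rfl, hc0', hc0, hne⟩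
    obtain ⟨c, h1, h2, h3, h4⟩ := Nat.find_spec hex
    refine ⟨c, ⟨h3, ?_, h4⟩, ?_⟩
    · by_contra hcb
      exact h4 (hbig c (by omega) h2)
    · intro d h5 h6
      by_contra h7
      exact Nat.find_min hex (m := n - d) (by omega) ⟨d, rfl, h6, by omega, h7⟩
  have hnd : ¬ Desc n I w c := fun hd => by
    have := par_le I (by omega) hc (by omega) hd
    omega
  unfold Desc at hnd
  push Not at hnd
  obtain ⟨d, hd, hd', hdne⟩ := hnd
  have hdd := hmax d hd hd'
  rcases Nat.lt_or_ge (I d w) (I d c) with hlt | hge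
  · have e1 := h.trans v c d (by omega) hd
    have e2 := h.trans w c d (by omega) hd
    omega
  · have e1 := h.plan v c d hv (by omega) hd hd'
    have e2 := h.plan w c d (by omega) (by omega) hd hd'
    omega

/-- The tree with a given tree-inversion set. -/
noncomputable def toTree (h : IsTreeInv n s I) : SDecTree n s where
  parent := par n I
  idx := fun v => if 1 ≤ v ∧ v < n then I (par n I v) v else 0
  parent_gt := fun v h1 h2 => (par_spec I ⟨h1, h2⟩).1
  parent_le := fun v h1 h2 => (par_spec I ⟨h1, h2⟩).2.1
  idx_le := fun v h1 h2 => by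
    rw [if_pos ⟨h1, h2⟩]; exact h.le _ _
  slot_inj := by
    intro v w h1 h2 h3 h4 hp hi
    simp only [h1, h2, h3, h4, and_self, if_true] at hi
    rcases lt_trichotomy v w with hlt | heq | hlt
    · exact (slot_aux h h1 hlt h4 hp hi).elim
    · exact heq
    · exact (slot_aux h h3 hlt h2 hp.symm hi.symm).elim
  parent_out := fun v hv => by
    unfold par
    rw [if_neg (by omega)]
  idx_out := fun v hv => by
    rw [if_neg (by omega)]

theorem toTree_descend (h : IsTreeInv n s I) {x y : ℕ} (hd : h.toTree.Descend x y) :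
    Desc n I x y := by
  refine SDecTree.Descend.induct (P := fun x => Desc n I x y) (fun _ _ c _ _ => rfl) ?_ x hd
  intro x h1 h2 h3 h4 c hc hc'
  have h5 := (par_spec I (n := n) (a := x) ⟨h1, h2⟩).2.2
  have h6 := h3.le
  have h7 : h.toTree.parent x = par n I x := rfl
  rw [h7] at h4 h6
  rw [h5 c (by omega) hc', h4 c hc hc']

theorem descend_toTree (h : IsTreeInv n s I) {y : ℕ} (hy : y ≤ n) :
    ∀ m x, n - x = m → 1 ≤ x → x ≤ y → Desc n I x y → h.toTree.Descend x y := by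
  intro m
  induction m using Nat.strong_induction_on with
  | _ m ih =>
    intro x hm hx hxy hd
    rcases Nat.lt_or_ge x y with hlt | hge
    · obtain ⟨a1, a2, a3⟩ := par_spec I (n := n) (a := x) (by omega)
      have a4 := par_le I hx hlt hy hd
      refine (SDecTree.descend_iff _).2 ⟨hx, by omega, Or.inr ?_⟩
      refine ih (n - par n I x) (by omega) _ rfl (by show 1 ≤ par n I x; omega) a4 ?_
      intro c hc hc'
      show I c (par n I x) = _
      rw [← a3 c (by omega) hc', hd c hc hc']
    · obtain rfl : x = y := by omega
      exact SDecTree.Descend.refl _ hx hy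

theorem toTree_inSub (h : IsTreeInv n s I) {x y j : ℕ} (hy : 1 ≤ y)
    (hd : h.toTree.InSub y j x) : j = I y x := by
  obtain ⟨c, h1, h2, h3⟩ := hd
  have hc : 1 ≤ c ∧ c < n := by
    by_contra hc
    have := h.toTree.parent_out c (by omega)
    omega
  have h2' : par n I c = y := h2
  have h3' : (if 1 ≤ c ∧ c < n then I (par n I c) c else 0) = j := h3
  rw [if_pos hc, h2'] at h3'
  obtain ⟨a1, a2, a3⟩ := par_spec I (n := n) (a := c) hc
  rw [toTree_descend h h1 y (by omega) (by omega)]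
  exact h3'.symm

theorem toTree_card (h : IsTreeInv n s I) (y x : ℕ) : h.toTree.card y x = I y x := by
  by_cases hr : 1 ≤ x ∧ x < y ∧ y ≤ n
  · obtain ⟨hx, hxy, hy⟩ := hr
    rcases h.toTree.tri_lt hx hxy hy with h2 | h2 | h2
    · exact toTree_inSub h (by omega) h2
    · rw [SDecTree.card_left h2]
      obtain ⟨z, j₁, j₂, hz, k1, k2, k3⟩ := h2.exists_pos
      have e1 := toTree_inSub h hz k2
      have e2 := toTree_inSub h hz k3
      have := h.trans x y z hxy (k3.descend hz).2.1
      omega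
    · rw [SDecTree.card_right h2 hxy]
      obtain ⟨z, j₁, j₂, hz, k1, k2, k3⟩ := h2.exists_pos
      have e1 := toTree_inSub h hz k2
      have e2 := toTree_inSub h hz k3
      have := h.plan x y z hx hxy (k2.descend hz).2.1 (k2.descend hz).1.le_n'
      omega
  · rw [h.out y x hr, h.toTree.card_out hr]

end IsTreeInv

/-- reachability through positive entries -/
def Reach (M : ℕ → ℕ → ℕ) : ℕ → ℕ → Prop :=
  Relation.ReflTransGen (fun u v => v < u ∧ 0 < M u v)

/-- explicit transitive closure -/
noncomputable def clInv (M : ℕ → ℕ → ℕ) : ℕ → ℕ → ℕ := fun c a =>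
  ((Finset.range c).filter (fun x => Reach M x a)).sup (M c)

theorem Reach.le {M : ℕ → ℕ → ℕ} {x a : ℕ} (h : Reach M x a) : a ≤ x := by
  induction h with
  | refl => exact le_rfl
  | tail _ h ih => exact h.1.le.trans ih

theorem le_clInv {M : ℕ → ℕ → ℕ} {c x a : ℕ} (hx : x < c) (hr : Reach M x a) :
    M c x ≤ clInv M c a := by
  unfold clInv
  exact Finset.le_sup (f := M c) (by simp [hx, hr])

theorem self_le_clInv {M : ℕ → ℕ → ℕ} (h0 : ∀ y x, ¬ x < y → M y x = 0) (y x : ℕ) :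
    M y x ≤ clInv M y x := by
  by_cases h : x < y
  · exact le_clInv h Relation.ReflTransGen.refl
  · rw [h0 y x h]; omega

theorem clInv_pos {M : ℕ → ℕ → ℕ} {c a : ℕ} (h : 0 < clInv M c a) :
    ∃ x, x < c ∧ Reach M x a ∧ M c x = clInv M c a := by
  unfold clInv at h ⊢
  set F := (Finset.range c).filter (fun x => Reach M x a) with hF
  have hne : F.Nonempty := by
    by_contra hc
    rw [Finset.not_nonempty_iff_eq_empty] at hc
    rw [hc] at h
    simp at h
  obtain ⟨x, hx, hx'⟩ := Finset.exists_mem_eq_sup F hne (M c)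
  rw [hF] at hx
  simp only [Finset.mem_filter, Finset.mem_range] at hx
  exact ⟨x, hx.1, hx.2, hx'.symm⟩

theorem clInv_trans (M : ℕ → ℕ → ℕ) : IsTransitiveInv (clInv M) := by
  intro a b c hab hbc
  rcases Nat.eq_zero_or_pos (clInv M b a) with h | h
  · exact Or.inl h
  · right
    obtain ⟨x, hx, hr, he⟩ := clInv_pos h
    have hba : Reach M b a := Relation.ReflTransGen.head ⟨hx, by omega⟩ hr
    rcases Nat.eq_zero_or_pos (clInv M c b) with h' | h'
    · omega
    · obtain ⟨x', hx', hr', he'⟩ := clInv_pos h'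
      rw [← he']
      exact le_clInv hx' (hr'.trans hba)

theorem Reach.le_of_trans {M J : ℕ → ℕ → ℕ} (hJ : IsTransitiveInv J)
    (hM : ∀ y x, M y x ≤ J y x) {x a c : ℕ} (h : Reach M x a) (hx : x < c) : J c x ≤ J c a := by
  revert hx
  refine Relation.ReflTransGen.head_induction_on (motive := fun x _ => x < c → J c x ≤ J c a) h
    (fun _ => le_rfl) ?_
  intro u v huv _ ih hu
  have := hJ v u c huv.1 hu
  have := hM u v
  have := ih (by omega)
  omega

theorem clInv_le {M J : ℕ → ℕ → ℕ} (hJ : IsTransitiveInv J)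
    (hM : ∀ y x, M y x ≤ J y x) (y x : ℕ) : clInv M y x ≤ J y x := by
  rcases Nat.eq_zero_or_pos (clInv M y x) with h | h
  · omega
  · obtain ⟨u, hu, hr, he⟩ := clInv_pos h
    rw [← he]
    exact (hM y u).trans (hr.le_of_trans hJ hM hu)

theorem tcInv_eq {M : ℕ → ℕ → ℕ} (h0 : ∀ y x, ¬ x < y → M y x = 0) : tcInv M = clInv M := by
  funext y x
  unfold tcInv
  apply le_antisymm
  · exact Nat.sInf_le ⟨clInv M, clInv_trans M, self_le_clInv h0, rfl⟩
  · obtain ⟨J, h1, h2, h3⟩ := Nat.sInf_mem (s := {m | ∃ J : ℕ → ℕ → ℕ, IsTransitiveInv J ∧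
      (∀ y' x', M y' x' ≤ J y' x') ∧ J y x = m}) ⟨_, clInv M, clInv_trans M, self_le_clInv h0, rfl⟩
    rw [← h3]
    exact clInv_le h1 h2 y x

theorem clInv_isTreeInv {n : ℕ} {s : ℕ → ℕ} {M : ℕ → ℕ → ℕ}
    (hp : ∀ a b c, 1 ≤ a → a < b → b < c → c ≤ n → M b a = s b ∨ M c a ≤ M c b)
    (hle : ∀ y x, M y x ≤ s y) (hout : ∀ y x, ¬ (1 ≤ x ∧ x < y ∧ y ≤ n) → M y x = 0) :
    IsTreeInv n s (clInv M) := by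
  have hle' : ∀ y x, clInv M y x ≤ s y := fun y x => by
    unfold clInv
    exact Finset.sup_le fun u _ => hle y u
  refine ⟨clInv_trans M, ?_, hle', ?_⟩
  · intro a b c ha hab hbc hc
    have key : ∀ x, Reach M x a → x < b ∨ b = x ∨ (b < x ∧ (M b a = s b ∨ clInv M b a = s b ∨
        Reach M x b)) := by
      intro x hx
      refine Relation.ReflTransGen.head_induction_on (motive := fun x _ => x < b ∨ b = x ∨
        (b < x ∧ (M b a = s b ∨ clInv M b a = s b ∨ Reach M x b))) hx (Or.inl hab) ?_
      intro u v huv hva ih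
      rcases lt_trichotomy u b with h | h | h
      · exact Or.inl h
      · exact Or.inr (Or.inl h.symm)
      · refine Or.inr (Or.inr ⟨h, ?_⟩)
        rcases ih with h1 | h1 | ⟨h1, h2⟩
        · have hu : 1 ≤ v ∧ v < u ∧ u ≤ n := by
            by_contra hc
            have := hout u v hc
            omega
          rcases hp v b u hu.1 h1 h hu.2.2 with h3 | h3
          · right; left
            have := le_clInv h1 hva
            have := hle' b a
            omega
          · right; right
            exact Relation.ReflTransGen.single ⟨h, by omega⟩
        · right; right
          rw [h1]
          exact Relation.ReflTransGen.single huv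
        · rcases h2 with h2 | h2 | h2
          · exact Or.inl h2
          · exact Or.inr (Or.inl h2)
          · exact Or.inr (Or.inr (Relation.ReflTransGen.head huv h2))
    have hM : M b a ≤ clInv M b a := le_clInv hab Relation.ReflTransGen.refl
    have hb := hle' b a
    rcases Nat.eq_zero_or_pos (clInv M c a) with h | h
    · right; omega
    · obtain ⟨x, hx, hr, he⟩ := clInv_pos h
      have hxp : 1 ≤ x := by have := hr.le; omega
      rcases key x hr with h1 | h1 | ⟨h1, h2⟩
      · rcases hp x b c hxp h1 hbc hc with h3 | h3
        · left
          have := le_clInv h1 hr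
          omega
        · right
          have := le_clInv (M := M) hbc (Relation.ReflTransGen.refl (a := b))
          omega
      · right
        subst h1
        have := le_clInv (M := M) hx (Relation.ReflTransGen.refl (a := b))
        omega
      · rcases h2 with h2 | h2 | h2
        · left; omega
        · left; omega
        · right
          have := le_clInv hx h2
          omega
  · intro y x hn
    by_contra hne
    obtain ⟨u, hu, hr, he⟩ := clInv_pos (Nat.pos_of_ne_zero hne)
    have hur : 1 ≤ u ∧ u < y ∧ y ≤ n := by
      by_contra hc
      have := hout y u hc
      omega
    have hx : x = 0 := by have := hr.le; omega
    subst hx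
    rcases Relation.ReflTransGen.cases_tail hr with h | ⟨v, _, hv⟩
    · omega
    · have := hout v 0 (by omega)
      omega

namespace SDecTree

variable {n : ℕ} {s : ℕ → ℕ}

theorem inSub_card {T : SDecTree n s} {x y j : ℕ} (h : T.InSub y j x) :
    T.InSub y (T.card y x) x := by
  rw [card_inSub h]; exact h

theorem TreeAscent.inSub {T : SDecTree n s} {a b : ℕ} (h : T.TreeAscent a b) :
    T.InSub b (T.card b a) a ∧ T.card b a < s b := by
  obtain ⟨_, _, _, ⟨i, h1, h2⟩, _⟩ := h
  rw [card_inSub h2]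
  exact ⟨h2, h1⟩

theorem TreeAscent.unique {T : SDecTree n s} {a b b' : ℕ} (h : T.TreeAscent a b)
    (h' : T.TreeAscent a b') : b = b' := by
  have key : ∀ b b', T.TreeAscent a b → T.TreeAscent a b' → ¬ b < b' := by
    intro b b' h h' hlt
    have h1 := h.inSub
    have := h'.2.2.2.2.1 b _ h.2.1 hlt h1.1
    omega
  rcases lt_trichotomy b b' with hl | hl | hl
  · exact (key _ _ h h' hl).elim
  · exact hl
  · exact (key _ _ h' h hl).elim

theorem TreeAscent.not_left {T : SDecTree n s} {a b w : ℕ} (h : T.TreeAscent a b)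
    (hw : T.InSub b (T.card b a) w) : ¬ T.LeftOf a w := by
  intro hl
  obtain ⟨z, j₁, j₂, hz, h1, h2, h3⟩ := hl.exists_pos
  have hb : 1 ≤ b := by have := h.2.1; omega
  have ha := h.inSub.1
  have d1 := (ha.descend hb).1
  have d2 := (h2.descend hz).1
  have d3 := (hw.descend hb).1
  rcases d1.comparable d2 with hd | hd
  · rcases hd.cases with rfl | ⟨k, hk⟩
    · have := h2.unique ha
      have := h3.unique hw
      omega
    · have := (hk.of_descend d1).unique h2
      have := (hk.of_descend d3).unique h3
      omega
  · rcases hd.cases with rfl | ⟨k, hk⟩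
    · have := h2.unique ha
      have := h3.unique hw
      omega
    · have e1 := h.2.2.2.2.1 z j₁ (h2.descend hz).2.1 (hk.descend hb).2.1 h2
      have e2 := (h3.descend hz).2.2
      omega

theorem InSubMinus0.descend {T : SDecTree n s} {a x : ℕ} (ha : 1 ≤ a) (ha' : a ≤ n)
    (h : T.InSubMinus0 a x) : T.Descend x a := by
  rcases h with rfl | ⟨j, _, hj⟩
  · exact Descend.refl T ha ha'
  · exact (hj.descend ha).1

theorem TreeAscent.rangeA {T : SDecTree n s} {a b : ℕ} (h : T.TreeAscent a b) :
    1 ≤ a ∧ a ≤ n ∧ 1 ≤ b ∧ b ≤ n ∧ a < b := by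
  obtain ⟨h1, h2, h3, _⟩ := h
  omega

theorem TreeAscent.minus0 {T : SDecTree n s} {a b x : ℕ} (h : T.TreeAscent a b)
    (hx : T.InSubMinus0 a x) : T.Descend x a ∧ T.InSub b (T.card b a) x ∧
      T.card b x = T.card b a := by
  obtain ⟨h1, h2, h3, h4, h5⟩ := h.rangeA
  have hd := hx.descend h1 h2
  have := h.inSub.1.of_descend hd
  exact ⟨hd, this, card_inSub this⟩

/-- two ascents to the same vertex from the same subtree -/
theorem TreeAscent.two {T : SDecTree n s} {a a' b : ℕ} (h : T.TreeAscent a b)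
    (h' : T.TreeAscent a' b) (hc : T.card b a = T.card b a') :
    a = a' ∨ (s a' = 0 ∧ T.Descend a a') ∨ (s a = 0 ∧ T.Descend a' a) := by
  have key : ∀ a a', T.TreeAscent a b → T.TreeAscent a' b → T.Descend a a' →
      a = a' ∨ (s a' = 0 ∧ T.Descend a a') := by
    intro a a' h h' hd
    rcases hd.cases with h1 | ⟨j, hj⟩
    · exact Or.inl h1
    · right
      refine ⟨?_, hd⟩
      by_contra hs
      have e := h.2.2.2.2.1 a' j (hj.descend h'.1).2.1 h'.2.1 hj
      subst e
      exact h'.2.2.2.2.2 (Nat.pos_of_ne_zero hs) a hj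
  obtain ⟨h1, h2, h3, h4, h5⟩ := h.rangeA
  obtain ⟨h1', h2', h3', h4', h5'⟩ := h'.rangeA
  rcases T.tri h1 h2 h1' h2' with hd | hd | hl | hl
  · rcases key a a' h h' hd with h6 | h6
    · exact Or.inl h6
    · exact Or.inr (Or.inl h6)
  · rcases key a' a h' h hd with h6 | h6
    · exact Or.inl h6.symm
    · exact Or.inr (Or.inr h6)
  · exact (h.not_left (by rw [hc]; exact h'.inSub.1) hl).elim
  · exact (h'.not_left (by rw [← hc]; exact h.inSub.1) hl).elim

theorem TreeAscent.minus0_unique {T : SDecTree n s} {a a' b x : ℕ} (h : T.TreeAscent a b)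
    (h' : T.TreeAscent a' b) (hx : T.InSubMinus0 a x) (hx' : T.InSubMinus0 a' x) : a = a' := by
  have key : ∀ a a', T.TreeAscent a b → T.TreeAscent a' b → T.InSubMinus0 a x →
      T.InSubMinus0 a' x → s a' = 0 → T.Descend a a' → a = a' := by
    intro a a' h h' hx hx' hs hd
    have h1 := (h.minus0 hx).1.le
    have h2 := hd.le
    rcases hx' with rfl | ⟨j, hj, hj'⟩
    · omega
    · have := (hj'.descend h'.1).2.2
      omega
  have e1 := (h.minus0 hx).2.2
  have e2 := (h'.minus0 hx').2.2
  rcases h.two h' (by omega) with h1 | ⟨h1, h2⟩ | ⟨h1, h2⟩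
  · exact h1
  · exact key a a' h h' hx hx' h1 h2
  · exact (key a' a h' h hx' hx h1 h2).symm

/-- `inv T` plus one copy of all the sets `A_T(a,b)`, `(a,b) ∈ S` -/
noncomputable def rot (T : SDecTree n s) (S : Set (ℕ × ℕ)) : ℕ → ℕ → ℕ := fun y x =>
  T.card y x + if ∃ a, (a, y) ∈ S ∧ T.InSubMinus0 a x then 1 else 0

theorem rot_pos {T : SDecTree n s} {S : Set (ℕ × ℕ)} {y x a : ℕ} (h : (a, y) ∈ S)
    (h' : T.InSubMinus0 a x) : T.rot S y x = T.card y x + 1 := by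
  unfold rot
  rw [if_pos ⟨a, h, h'⟩]

theorem rot_neg {T : SDecTree n s} {S : Set (ℕ × ℕ)} {y x : ℕ}
    (h : ¬ ∃ a, (a, y) ∈ S ∧ T.InSubMinus0 a x) : T.rot S y x = T.card y x := by
  unfold rot
  rw [if_neg h]; rfl

theorem card_le_rot (T : SDecTree n s) (S : Set (ℕ × ℕ)) (y x : ℕ) :
    T.card y x ≤ T.rot S y x := by
  unfold rot; omega

theorem rot_le (T : SDecTree n s) {S : Set (ℕ × ℕ)} (hS : ∀ a b, (a, b) ∈ S → T.TreeAscent a b)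
    (y x : ℕ) : T.rot S y x ≤ s y := by
  by_cases h : ∃ a, (a, y) ∈ S ∧ T.InSubMinus0 a x
  · obtain ⟨a, h1, h2⟩ := h
    rw [rot_pos h1 h2]
    have h3 := (hS _ _ h1).inSub
    have := ((hS _ _ h1).minus0 h2).2.2
    omega
  · rw [rot_neg h]; exact T.card_le _ _

theorem rot_out (T : SDecTree n s) {S : Set (ℕ × ℕ)} (hS : ∀ a b, (a, b) ∈ S → T.TreeAscent a b)
    (y x : ℕ) (hr : ¬ (1 ≤ x ∧ x < y ∧ y ≤ n)) : T.rot S y x = 0 := by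
  by_cases h : ∃ a, (a, y) ∈ S ∧ T.InSubMinus0 a x
  · exfalso
    obtain ⟨a, h1, h2⟩ := h
    have h3 := ((hS _ _ h1).minus0 h2).1
    have h4 := (hS _ _ h1).rangeA
    have := h3.pos
    have := h3.le
    omega
  · rw [rot_neg h]; exact T.card_out hr

theorem rot_plan (T : SDecTree n s) {S : Set (ℕ × ℕ)} (hS : ∀ a b, (a, b) ∈ S → T.TreeAscent a b)
    (a b c : ℕ) (ha : 1 ≤ a) (hab : a < b) (hbc : b < c) (hc : c ≤ n) :
    T.rot S b a = s b ∨ T.rot S c a ≤ T.rot S c b := by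
  have l1 := T.card_le_rot S b a
  have l2 := T.rot_le hS b a
  have l3 := T.card_le_rot S c b
  have l4 := T.rot_le hS c a
  by_cases h : ∃ a', (a', c) ∈ S ∧ T.InSubMinus0 a' a
  · obtain ⟨a', h1, h2⟩ := h
    have hA := hS _ _ h1
    obtain ⟨m1, m2, m3⟩ := hA.minus0 h2
    obtain ⟨r1, r2, r3, r4, r5⟩ := hA.rangeA
    have e0 := rot_pos h1 h2
    rcases T.tri_lt ha hab (by omega) with k | k | k
    · have kd := (k.descend (by omega)).1
      have kc := card_desc kd hbc hc
      rcases m1.comparable kd with hd | hd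
      · rcases hd.cases with rfl | ⟨j, hj⟩
        · right
          have := rot_pos h1 (Or.inl rfl : T.InSubMinus0 a' a')
          omega
        · left
          have e1 := hA.2.2.2.2.1 b j (hj.descend (by omega)).2.1 hbc hj
          have e2 := card_inSub (hj.of_descend m1)
          omega
      · right
        have hb : T.InSubMinus0 a' b := by
          rcases hd.cases with h3 | ⟨j, hj⟩
          · exact Or.inl h3
          · right
            rcases h2 with rfl | ⟨j', hj', hjpp⟩
            · have := hd.le
              omega
            · have := hjpp.unique (hj.of_descend kd)
              subst this
              exact ⟨_, hj', hj⟩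
        have := rot_pos h1 hb
        omega
    · rcases T.tri_lt (x := b) (by omega) hbc hc with q | q | q
      · have mono := card_mono k (by omega) hbc hc
        rcases Nat.lt_or_ge (T.card c a) (T.card c b) with h3 | h3
        · right; omega
        · have h4 : T.card c b = T.card c a' := by omega
          rw [h4] at q
          have hbn : b ≤ n := by omega
          have hbb := Descend.refl T (x := b) (by omega) hbn
          rcases T.tri r1 r2 (by omega : 1 ≤ b) hbn with t | t | t | t
          · exact (k.not_descend (m1.trans t)).elim
          · right
            have hb : T.InSubMinus0 a' b := by
              rcases t.cases with h5 | ⟨j, hj⟩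
              · exact Or.inl h5
              · right
                refine ⟨j, ?_, hj⟩
                rcases h2 with rfl | ⟨j', hj', hjpp⟩
                · exact (k.not_descend' t).elim
                · have e1 := card_mono k (hjpp.descend r1).2.1 (hj.descend r1).2.1 r2
                  rw [card_inSub hj, card_inSub hjpp] at e1
                  omega
            have := rot_pos h1 hb
            omega
          · exact (hA.not_left q t).elim
          · exact (k.asymm (t.desc hbb m1)).elim
      · exfalso
        exact (k.trans q).not_descend (m2.descend r3).1
      · right
        have := card_right q hbc
        omega
    · left
      have := card_right k hab
      omega
  · have e := rot_neg h
    rcases T.isTreeInv_card.plan a b c ha hab hbc hc with h1 | h1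
    · left; omega
    · right; omega

theorem isTreeInv_cl_rot (T : SDecTree n s) {S : Set (ℕ × ℕ)}
    (hS : ∀ a b, (a, b) ∈ S → T.TreeAscent a b) : IsTreeInv n s (clInv (T.rot S)) :=
  clInv_isTreeInv (T.rot_plan hS) (T.rot_le hS) (T.rot_out hS)

theorem rot_single_trans (T : SDecTree n s) {a b : ℕ} (hA : T.TreeAscent a b) :
    IsTransitiveInv (T.rot {(a, b)}) := by
  have hS : ∀ a' b', (a', b') ∈ ({(a, b)} : Set (ℕ × ℕ)) → T.TreeAscent a' b' := by
    intro a' b' h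
    simp only [Set.mem_singleton_iff, Prod.mk.injEq] at h
    obtain ⟨rfl, rfl⟩ := h
    exact hA
  obtain ⟨r1, r2, r3, r4, r5⟩ := hA.rangeA
  intro x y z hxy hyz
  rcases Nat.eq_zero_or_pos (T.rot {(a, b)} y x) with h0 | h0
  · exact Or.inl h0
  right
  have hr : 1 ≤ x ∧ y ≤ n := by
    by_contra hc
    have := T.rot_out hS y x (by omega)
    omega
  by_cases hz : z ≤ n
  swap
  · rw [T.rot_out hS z y (by omega)]; omega
  have l1 := T.card_le_rot {(a, b)} z x
  by_cases h : ∃ a', (a', z) ∈ ({(a, b)} : Set (ℕ × ℕ)) ∧ T.InSubMinus0 a' y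
  · obtain ⟨a', h1, h2⟩ := h
    have h1' := h1
    simp only [Set.mem_singleton_iff, Prod.mk.injEq] at h1'
    obtain ⟨rfl, rfl⟩ := h1'
    obtain ⟨m1, m2, m3⟩ := hA.minus0 h2
    have e0 := rot_pos h1 h2
    have e1 : T.rot {(a', z)} y x = T.card y x := by
      apply rot_neg
      rintro ⟨app, h3, h4⟩
      simp only [Set.mem_singleton_iff, Prod.mk.injEq] at h3
      omega
    rw [e1] at h0
    have goal_of : T.InSubMinus0 a' x → T.card z x = T.card z y →
        T.rot {(a', z)} z y ≤ T.rot {(a', z)} z x := by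
      intro h3 h4
      rw [e0, rot_pos h1 h3]
      omega
    rcases T.tri_lt hr.1 hxy hr.2 with k | k | k
    · have kd := (k.descend (by omega)).1
      refine goal_of ?_ (card_desc kd hyz hz)
      rcases h2 with rfl | ⟨j, hj, hj'⟩
      · exact Or.inr ⟨_, h0, k⟩
      · exact Or.inr ⟨j, hj, hj'.of_descend kd⟩
    · rw [card_left k] at h0; omega
    · have mono := card_mono k hyz (by omega) hz
      rcases Nat.lt_or_ge (T.card z y) (T.card z x) with h3 | h3
      · omega
      have hxz : T.card z x = T.card z a' := by omega
      have hyy := Descend.refl T (x := y) (by omega) hr.2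
      have hxx := Descend.refl T (x := x) (by omega) (by omega)
      have hzz := Descend.refl T r3 r4
      have q : T.InSub z (T.card z a') x := by
        rcases T.tri_lt (x := x) (y := z) hr.1 (by omega) hz with q | q | q
        · rw [← hxz]; exact q
        · exact (k.asymm (q.desc hxx (m2.descend r3).1)).elim
        · have := card_right q (by omega)
          have := hA.inSub.2
          omega
      refine goal_of ?_ (by omega)
      rcases T.tri r1 r2 hr.1 (by omega : x ≤ n) with t | t | t | t
      · exact (k.not_descend (m1.trans t)).elim
      · rcases t.cases with h5 | ⟨j, hj⟩
        · exact Or.inl h5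
        · right
          refine ⟨j, ?_, hj⟩
          rcases h2 with rfl | ⟨j', hj', hjpp⟩
          · exact (k.not_descend' t).elim
          · have e1 := card_mono k (hjpp.descend r1).2.1 (hj.descend r1).2.1 r2
            rw [card_inSub hj, card_inSub hjpp] at e1
            omega
      · exact (hA.not_left q t).elim
      · exact (k.asymm (t.desc hxx m1)).elim
  · rw [rot_neg h]
    by_cases h' : ∃ a', (a', y) ∈ ({(a, b)} : Set (ℕ × ℕ)) ∧ T.InSubMinus0 a' x
    · obtain ⟨a', h1, h2⟩ := h'
      have hA' := hS _ _ h1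
      obtain ⟨m1, m2, m3⟩ := hA'.minus0 h2
      have := card_desc (m2.descend (by omega)).1 hyz hz
      omega
    · rw [rot_neg h'] at h0
      have := T.isTreeInv_card.trans x y z hxy hyz
      omega

/-- minimality of the closure -/
theorem rot_le_of_trans (T : SDecTree n s) {S : Set (ℕ × ℕ)}
    (hS : ∀ a b, (a, b) ∈ S → T.TreeAscent a b) {J : ℕ → ℕ → ℕ} (hJ : IsTransitiveInv J)
    (hTJ : ∀ y x, T.card y x ≤ J y x) (hSJ : ∀ a b, (a, b) ∈ S → T.card b a < J b a)
    (y x : ℕ) : T.rot S y x ≤ J y x := by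
  by_cases h : ∃ a, (a, y) ∈ S ∧ T.InSubMinus0 a x
  · obtain ⟨a, h1, h2⟩ := h
    have hA := hS _ _ h1
    obtain ⟨m1, m2, m3⟩ := hA.minus0 h2
    rw [rot_pos h1 h2, m3]
    have h3 := hSJ _ _ h1
    rcases h2 with rfl | ⟨j, hj, hj'⟩
    · omega
    · have e1 := hJ x a y (hj'.descend hA.1).2.1 hA.2.1
      have e2 := hTJ a x
      rw [card_inSub hj'] at e2
      omega
  · rw [rot_neg h]; exact hTJ y x

theorem tcInv_addInv (T : SDecTree n s) {a b : ℕ} (hA : T.TreeAscent a b) :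
    tcInv (addInv s T.card b a) = T.rot {(a, b)} := by
  have hS : ∀ a' b', (a', b') ∈ ({(a, b)} : Set (ℕ × ℕ)) → T.TreeAscent a' b' := by
    intro a' b' h
    simp only [Set.mem_singleton_iff, Prod.mk.injEq] at h
    obtain ⟨rfl, rfl⟩ := h
    exact hA
  obtain ⟨r1, r2, r3, r4, r5⟩ := hA.rangeA
  have hlt := hA.inSub.2
  have h0 : ∀ y x, ¬ x < y → addInv s T.card b a y x = 0 := by
    intro y x hxy
    unfold addInv
    rw [if_neg (by omega)]
    exact T.card_out (by omega)
  have hle : ∀ y x, T.card y x ≤ addInv s T.card b a y x := by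
    intro y x
    unfold addInv
    split_ifs with h
    · obtain ⟨rfl, rfl⟩ := h
      omega
    · exact le_rfl
  rw [tcInv_eq h0]
  funext y x
  apply le_antisymm
  · apply clInv_le (T.rot_single_trans hA)
    intro y x
    unfold addInv
    split_ifs with h
    · obtain ⟨rfl, rfl⟩ := h
      rw [rot_pos (Set.mem_singleton _) (Or.inl rfl)]
      omega
    · exact T.card_le_rot _ _ _
  · apply T.rot_le_of_trans hS (clInv_trans _)
    · intro y x
      exact (hle y x).trans (self_le_clInv h0 y x)
    · intro a' b' h
      simp only [Set.mem_singleton_iff, Prod.mk.injEq] at h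
      obtain ⟨rfl, rfl⟩ := h
      refine lt_of_lt_of_le ?_ (self_le_clInv h0 b' a')
      unfold addInv
      rw [if_pos ⟨rfl, rfl⟩]
      omega

theorem mem_ARot (T : SDecTree n s) {a b y x : ℕ} (hA : T.TreeAscent a b) :
    (y, x) ∈ ARot T a b ↔ y = b ∧ T.InSubMinus0 a x := by
  unfold ARot
  rw [tcInv_addInv T hA]
  simp only [Set.mem_setOf_eq]
  constructor
  · intro h
    by_contra hc
    rw [rot_neg] at h
    · omega
    · rintro ⟨a', h1, h2⟩
      simp only [Set.mem_singleton_iff, Prod.mk.injEq] at h1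
      obtain ⟨rfl, rfl⟩ := h1
      exact hc ⟨rfl, h2⟩
  · rintro ⟨rfl, h⟩
    rw [rot_pos (Set.mem_singleton _) h]
    omega

/-- the ascents of `T` that are inverted in `Z` -/
def ascSet (T Z : SDecTree n s) : Set (ℕ × ℕ) :=
  {p : ℕ × ℕ | T.TreeAscent p.1 p.2 ∧ T.card p.2 p.1 < Z.card p.2 p.1}

theorem ascSum_eq (T Z : SDecTree n s) : ascSum n s T Z = T.rot (ascSet T Z) := by
  have hS : ∀ a b, (a, b) ∈ ascSet T Z → T.TreeAscent a b := fun a b h => h.1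
  funext y x
  unfold ascSum
  have key : T.card y x + {p : ℕ × ℕ | T.TreeAscent p.1 p.2 ∧ T.card p.2 p.1 < Z.card p.2 p.1 ∧
        (y, x) ∈ SDecTree.ARot T p.1 p.2}.ncard = T.rot (ascSet T Z) y x := by
    by_cases h : ∃ a, (a, y) ∈ ascSet T Z ∧ T.InSubMinus0 a x
    · obtain ⟨a, h1, h2⟩ := h
      rw [rot_pos h1 h2]
      congr 1
      rw [Set.ncard_eq_one]
      refine ⟨(a, y), ?_⟩
      ext ⟨a', b'⟩
      simp only [Set.mem_setOf_eq, Set.mem_singleton_iff, Prod.mk.injEq]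
      constructor
      · rintro ⟨q1, q2, q3⟩
        rw [mem_ARot T q1] at q3
        obtain ⟨rfl, q4⟩ := q3
        exact ⟨q1.minus0_unique h1.1 q4 h2, rfl⟩
      · rintro ⟨rfl, rfl⟩
        exact ⟨h1.1, h1.2, (mem_ARot T h1.1).2 ⟨rfl, h2⟩⟩
    · rw [rot_neg h]
      have : {p : ℕ × ℕ | T.TreeAscent p.1 p.2 ∧ T.card p.2 p.1 < Z.card p.2 p.1 ∧
        (y, x) ∈ SDecTree.ARot T p.1 p.2} = ∅ := by
        rw [Set.eq_empty_iff_forall_notMem]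
        rintro ⟨a', b'⟩ ⟨q1, q2, q3⟩
        rw [mem_ARot T q1] at q3
        obtain ⟨rfl, q4⟩ := q3
        exact h ⟨a', ⟨q1, q2⟩, q4⟩
      rw [this]
      simp
  rw [key]
  exact min_eq_left (T.rot_le hS y x)

/-- ascents outside `S` are not inverted in the closure -/
theorem cl_rot_of_not_mem (T : SDecTree n s) {S : Set (ℕ × ℕ)}
    (hS : ∀ a b, (a, b) ∈ S → T.TreeAscent a b) {a b : ℕ} (hA : T.TreeAscent a b)
    (hn : (a, b) ∉ S) : clInv (T.rot S) b a ≤ T.card b a := by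
  obtain ⟨r1, r2, r3, r4, r5⟩ := hA.rangeA
  have key : ∀ x, Reach (T.rot S) x a → x < b → T.card b x ≤ T.card b a := by
    intro x hx
    refine Relation.ReflTransGen.head_induction_on
      (motive := fun x _ => x < b → T.card b x ≤ T.card b a) hx (fun _ => le_rfl) ?_
    intro u v huv _ ih hu
    refine le_trans ?_ (ih (by omega))
    by_cases h : ∃ a', (a', u) ∈ S ∧ T.InSubMinus0 a' v
    · obtain ⟨a', h1, h2⟩ := h
      have hA' := hS _ _ h1
      have hr := hA'.rangeA
      exact (card_desc ((hA'.minus0 h2).2.1.descend (by omega)).1 hu r4).ge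
    · have := huv.2
      rw [rot_neg h] at this
      have := T.isTreeInv_card.trans v u b huv.1 hu
      omega
  by_contra hc
  obtain ⟨x, hx, hr, he⟩ := clInv_pos (M := T.rot S) (c := b) (a := a) (by omega)
  have h1 := key x hr hx
  have hax := hr.le
  by_cases h : ∃ a', (a', b) ∈ S ∧ T.InSubMinus0 a' x
  · obtain ⟨a', h2, h3⟩ := h
    have hA' := hS _ _ h2
    obtain ⟨m1, m2, m3⟩ := hA'.minus0 h3
    rw [rot_pos h2 h3] at he
    rcases hA.two hA' (by omega) with h4 | ⟨h4, h5⟩ | ⟨h4, h5⟩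
    · subst h4; exact hn h2
    · have hxa : x = a' := by
        rcases h3 with h3 | ⟨j, hj, hj'⟩
        · exact h3
        · have := (hj'.descend hA'.1).2.2
          omega
      subst hxa
      rcases Relation.ReflTransGen.cases_head hr with h6 | ⟨v, hv, _⟩
      · subst h6; exact hn h2
      · have := T.rot_le hS x v
        omega
    · have e1 := h5.le
      have e2 := m1.le
      have : a = a' := by omega
      subst this
      exact hn h2
  · rw [rot_neg h] at he
    omega

theorem exists_ascent {T U : SDecTree n s} (h : wlt T U) :
    ∃ a b, T.TreeAscent a b ∧ T.card b a < U.card b a := by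
  obtain ⟨hle, hnle⟩ := h
  unfold wle at hnle
  push Not at hnle
  obtain ⟨y0, x0, h0⟩ := hnle
  have hrange : ∀ y x, T.card y x < U.card y x → 1 ≤ x ∧ x < y ∧ y ≤ n := by
    intro y x h
    by_contra hc
    have := U.card_out hc
    omega
  have hex : ∃ y, ∃ x, T.card y x < U.card y x ∧ T.InSub y (T.card y x) x := by
    obtain ⟨hx, hxy, hy⟩ := hrange y0 x0 h0
    rcases T.tri_lt hx hxy hy with k | k | k
    · exact ⟨y0, x0, h0, k⟩
    · obtain ⟨z, j₁, j₂, hz, h1, h2, h3⟩ := k.exists_pos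
      refine ⟨z, x0, ?_, inSub_card h2⟩
      have e1 := U.isTreeInv_card.trans x0 y0 z hxy (h3.descend hz).2.1
      have e2 := hle z y0
      rw [card_inSub h3] at e2
      rw [card_inSub h2]
      omega
    · have e1 := card_right k hxy
      have e2 := U.card_le y0 x0
      omega
  have hmin := fun m => Nat.find_min hex (m := m)
  obtain ⟨x1, hx1, hx1'⟩ := Nat.find_spec hex
  set y := Nat.find hex with hy
  have hyr := hrange y x1 hx1
  have hypos : 1 ≤ y := by omega
  -- choose `x` with maximal label
  obtain ⟨x2, ⟨hx2, hx2'⟩, hmax⟩ : ∃ x2, (T.card y x2 < U.card y x2 ∧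
      T.InSub y (T.card y x2) x2) ∧ ∀ w, T.card y w < U.card y w ∧ T.InSub y (T.card y w) w →
      w ≤ x2 := by
    have hexm : ∃ m, ∃ x, n - x = m ∧ (T.card y x < U.card y x ∧ T.InSub y (T.card y x) x) :=
      ⟨_, x1, rfl, hx1, hx1'⟩
    obtain ⟨x2, h1, h2⟩ := Nat.find_spec hexm
    refine ⟨x2, h2, fun w hw => ?_⟩
    by_contra hc
    have := hrange y w hw.1
    exact Nat.find_min hexm (m := n - w) (by omega) ⟨w, rfl, hw⟩
  have hexX : ∃ x, (T.card y x < U.card y x ∧ T.InSub y (T.card y x) x) ∧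
      ∀ e j, x < e → e < y → T.InSub e j x → j = s e := by
    refine ⟨x2, ⟨hx2, hx2'⟩, ?_⟩
    intro e j he he' hj
    have hr := hrange y x2 hx2
    have hd := (hj.descend (by omega)).1
    have hcd := card_desc hd he' hr.2.2
    have hey : T.Descend e y := by
      rcases hd.comparable (hx2'.descend hypos).1 with h1 | h1
      · exact h1
      · have := h1.le
        omega
    have hcard := card_inSub hj
    have hUe : U.card e x2 = T.card e x2 := by
      by_contra hne
      have := hle e x2
      exact hmin e he' ⟨x2, by omega, inSub_card hj⟩
    rcases U.isTreeInv_card.plan x2 e y hr.1 he he' hr.2.2 with h1 | h1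
    · omega
    · exfalso
      have hin : T.InSub y (T.card y e) e := by
        rcases hey.cases with h2 | ⟨j', hj'⟩
        · omega
        · exact inSub_card hj'
      have := hmax e ⟨by omega, hin⟩
      omega
  obtain ⟨⟨ha1, ha2⟩, ha3⟩ := Nat.find_spec hexX
  have hmin2 := fun m => Nat.find_min hexX (m := m)
  set a := Nat.find hexX with ha
  have hr := hrange y a ha1
  refine ⟨a, y, ⟨hr.1, hr.2.1, hr.2.2, ⟨_, ?_, ha2⟩, ha3, ?_⟩, ha1⟩
  · have := U.card_le y a
    omega
  · intro hs x hx
    obtain ⟨c, h1, h2, h3⟩ := hx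
    have hcc : T.InSub a (s a) c := ⟨c, Descend.refl T (by have := h1.pos; have := h1.le; omega)
      h1.le_n', h2, h3⟩
    have hcd := hcc.descend hr.1
    refine hmin2 c hcd.2.1 ⟨⟨?_, ?_⟩, ?_⟩
    · have e1 := card_inSub hcc
      have e2 := hle a c
      have e3 := card_desc hcd.1 hr.2.1 hr.2.2
      have e4 := U.isTreeInv_card.trans c a y hcd.2.1 hr.2.1
      omega
    · exact inSub_card (ha2.of_descend hcd.1)
    · intro e j he he' hj
      have hd := (hj.descend (by omega)).1
      have hce : T.Descend a e := by
        obtain ⟨_, _, h4 | h4⟩ := T.descend_iff.1 hd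
        · omega
        · rw [h2] at h4; exact h4
      rcases hce.cases with h4 | ⟨k, hk⟩
      · subst h4
        exact hj.unique hcc
      · have e1 := ha3 e k (hk.descend (by omega)).2.1 he' hk
        have e2 := hj.unique (hk.of_descend hcd.1)
        omega

end SDecTree

namespace ChainReal

set_option linter.unusedSectionVars false

/-- geometric realization of the order complex of a finite poset -/
def real (α : Type*) [Fintype α] [PartialOrder α] : Set (α → ℝ) :=
  {x | (∀ a, 0 ≤ x a) ∧ (∀ a b, x a ≠ 0 → x b ≠ 0 → a ≤ b ∨ b ≤ a) ∧ ∑ a, x a = 1}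

variable {α β γ : Type*} [Fintype α] [PartialOrder α] [Fintype β] [PartialOrder β]
  [Fintype γ] [PartialOrder γ]

/-- push forward of vectors -/
noncomputable def pushFun (f : α → β) (x : α → ℝ) : β → ℝ :=
  fun b => ∑ a, if f a = b then x a else 0

theorem pushFun_nonneg (f : α → β) {x : α → ℝ} (hx : ∀ a, 0 ≤ x a) (b : β) :
    0 ≤ pushFun f x b := by
  unfold pushFun
  refine Finset.sum_nonneg fun a _ => ?_
  split_ifs
  · exact hx a
  · exact le_rfl

theorem pushFun_ne (f : α → β) {x : α → ℝ} {b : β} (h : pushFun f x b ≠ 0) :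
    ∃ a, f a = b ∧ x a ≠ 0 := by
  by_contra hc
  push Not at hc
  apply h
  unfold pushFun
  refine Finset.sum_eq_zero fun a _ => ?_
  split_ifs with h1
  · exact hc a h1
  · rfl

theorem pushFun_sum (f : α → β) (x : α → ℝ) : ∑ b, pushFun f x b = ∑ a, x a := by
  unfold pushFun
  rw [Finset.sum_comm]
  refine Finset.sum_congr rfl fun a _ => ?_
  simp

theorem pushFun_comp (f : α → β) (g : β → γ) (x : α → ℝ) :
    pushFun g (pushFun f x) = pushFun (g ∘ f) x := by
  funext c
  unfold pushFun
  simp only [Function.comp]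
  have : ∀ b, (if g b = c then ∑ a, (if f a = b then x a else 0) else 0) =
      ∑ a, if f a = b then (if g b = c then x a else 0) else 0 := by
    intro b
    split_ifs <;> simp
  rw [Finset.sum_congr rfl fun b _ => this b, Finset.sum_comm]
  refine Finset.sum_congr rfl fun a _ => ?_
  simp

theorem pushFun_id (x : α → ℝ) : pushFun (fun a : α => a) x = x := by
  funext c
  unfold pushFun
  simp

theorem continuous_pushFun (f : α → β) : Continuous (pushFun f) := by
  unfold pushFun
  refine continuous_pi fun b => continuous_finsetSum _ fun a _ => ?_
  split_ifs
  · exact continuous_apply a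
  · exact continuous_const

/-- map of realizations induced by a monotone map -/
noncomputable def push (f : α →o β) : C(real α, real β) where
  toFun x := ⟨pushFun f x.1, pushFun_nonneg f x.2.1, fun b b' hb hb' => by
    obtain ⟨a, rfl, ha⟩ := pushFun_ne _ hb
    obtain ⟨a', rfl, ha'⟩ := pushFun_ne _ hb'
    rcases x.2.2.1 a a' ha ha' with h | h
    · exact Or.inl (f.monotone h)
    · exact Or.inr (f.monotone h), by rw [pushFun_sum]; exact x.2.2.2⟩
  continuous_toFun := ((continuous_pushFun f).comp continuous_subtype_val).subtype_mk _

theorem push_comp (f : α →o β) (g : β →o γ) : (push g).comp (push f) = push (g.comp f) := by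
  ext x : 2
  exact pushFun_comp _ _ _

theorem push_id : push (OrderHom.id : α →o α) = ContinuousMap.id _ := by
  ext x : 2
  exact pushFun_id _

/-- mass strictly above `a` -/
noncomputable def up (x : α → ℝ) (a : α) : ℝ := ∑ c, if a < c then x c else 0

/-- moved mass -/
noncomputable def mv (t : ℝ) (x : α → ℝ) (a : α) : ℝ := min (max (t - up x a) 0) (x a)

theorem up_nonneg {x : α → ℝ} (hx : ∀ a, 0 ≤ x a) (a : α) : 0 ≤ up x a := by
  unfold up
  refine Finset.sum_nonneg fun c _ => ?_
  split_ifs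
  · exact hx c
  · exact le_rfl

theorem up_add_le {x : α → ℝ} (hx : ∀ a, 0 ≤ x a) (a : α) : up x a + x a ≤ ∑ c, x c := by
  have : x a = ∑ c, if a = c then x c else 0 := by simp
  unfold up
  rw [this, ← Finset.sum_add_distrib]
  refine Finset.sum_le_sum fun c _ => ?_
  have := hx c
  split_ifs with h1 h2
  · exact absurd h2 h1.ne
  · simp
  · simp
  · simpa using this

theorem up_add_le_up {x : α → ℝ} (hx : ∀ a, 0 ≤ x a) {a b : α} (hab : a < b) :
    up x b + x b ≤ up x a := by
  have : x b = ∑ c, if b = c then x c else 0 := by simp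
  unfold up
  rw [this, ← Finset.sum_add_distrib]
  refine Finset.sum_le_sum fun c _ => ?_
  have := hx c
  by_cases h1 : b < c
  · have h2 : b ≠ c := h1.ne
    have h3 : a < c := hab.trans h1
    simp [h1, h2, h3]
  · by_cases h2 : b = c
    · subst h2
      simp [hab]
    · simp only [h1, h2, if_false, add_zero]
      split_ifs
      · exact this
      · exact le_rfl

theorem mv_nonneg {x : α → ℝ} (hx : ∀ a, 0 ≤ x a) (t : ℝ) (a : α) : 0 ≤ mv t x a :=
  le_min (le_max_right _ _) (hx a)

theorem mv_le (x : α → ℝ) (t : ℝ) (a : α) : mv t x a ≤ x a := min_le_right _ _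

/-- the homotopy on vectors -/
noncomputable def hFun (f g : α → β) (t : ℝ) (x : α → ℝ) : β → ℝ :=
  fun b => pushFun f (fun a => x a - mv t x a) b + pushFun g (mv t x) b

theorem hFun_mem (f g : α →o β) (hfg : ∀ a, f a ≤ g a) (t : ℝ) {x : α → ℝ} (hx : x ∈ real α) :
    hFun f g t x ∈ real β := by
  obtain ⟨h0, hc, h1⟩ := hx
  have n1 : ∀ a, 0 ≤ x a - mv t x a := fun a => sub_nonneg.2 (mv_le x t a)
  have n2 := mv_nonneg h0 t
  refine ⟨fun b => add_nonneg (pushFun_nonneg f n1 b) (pushFun_nonneg g n2 b), ?_, ?_⟩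
  · have key : ∀ b, hFun f g t x b ≠ 0 → (∃ a, f a = b ∧ x a ≠ 0 ∧ t < up x a + x a) ∨
        (∃ a, g a = b ∧ x a ≠ 0 ∧ up x a < t) := by
      intro b hb
      by_cases hb1 : pushFun f (fun a => x a - mv t x a) b = 0
      · right
        have hb2 : pushFun g (mv t x) b ≠ 0 := by
          intro h; apply hb; unfold hFun; rw [hb1, h, add_zero]
        obtain ⟨a, ha, ha'⟩ := pushFun_ne _ hb2
        refine ⟨a, ha, ?_, ?_⟩
        · intro h
          apply ha'
          have := mv_le x t a
          have := n2 a
          linarith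
        · by_contra hlt
          apply ha'
          unfold mv
          rw [max_eq_right (by linarith), min_eq_left (h0 a)]
      · left
        obtain ⟨a, ha, ha'⟩ := pushFun_ne _ hb1
        refine ⟨a, ha, ?_, ?_⟩
        · intro h
          apply ha'
          have := n1 a
          have := n2 a
          linarith
        · by_contra hlt
          apply ha'
          unfold mv
          rw [min_eq_right]
          · ring
          · exact le_max_of_le_left (by linarith)
    have fg : ∀ a a', x a ≠ 0 → t < up x a + x a → x a' ≠ 0 → up x a' < t → f a ≤ g a' := by
      intro a a' ha ht ha' ht'
      by_cases haa : a ≤ a'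
      · exact (hfg a).trans (g.monotone haa)
      · exfalso
        have hlt : a' < a := by
          rcases hc a a' ha ha' with h | h
          · exact absurd h haa
          · exact lt_of_le_of_ne h fun e => haa e.ge
        have := up_add_le_up h0 hlt
        linarith
    intro b b' hb hb'
    rcases key b hb with ⟨a, rfl, ha, ht⟩ | ⟨a, rfl, ha, ht⟩ <;>
    rcases key b' hb' with ⟨a', rfl, ha', ht'⟩ | ⟨a', rfl, ha', ht'⟩
    · rcases hc a a' ha ha' with h | h
      · exact Or.inl (f.monotone h)
      · exact Or.inr (f.monotone h)
    · exact Or.inl (fg a a' ha ht ha' ht')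
    · exact Or.inr (fg a' a ha' ht' ha ht)
    · rcases hc a a' ha ha' with h | h
      · exact Or.inl (g.monotone h)
      · exact Or.inr (g.monotone h)
  · unfold hFun
    rw [Finset.sum_add_distrib, pushFun_sum, pushFun_sum, ← Finset.sum_add_distrib, ← h1]
    refine Finset.sum_congr rfl fun a _ => ?_
    ring

theorem continuous_mv : Continuous fun p : ℝ × (α → ℝ) => mv p.1 p.2 := by
  unfold mv up
  refine continuous_pi fun a => ?_
  refine Continuous.min (Continuous.max (continuous_fst.sub ?_) continuous_const)
    ((continuous_apply a).comp continuous_snd)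
  refine continuous_finsetSum _ fun c _ => ?_
  split_ifs
  · exact (continuous_apply c).comp continuous_snd
  · exact continuous_const

theorem continuous_hFun (f g : α → β) : Continuous fun p : ℝ × (α → ℝ) => hFun f g p.1 p.2 := by
  unfold hFun
  have h1 : Continuous fun p : ℝ × (α → ℝ) => pushFun g (mv p.1 p.2) :=
    (continuous_pushFun g).comp continuous_mv
  have h2 : Continuous fun p : ℝ × (α → ℝ) => pushFun f (fun a => p.2 a - mv p.1 p.2 a) :=
    (continuous_pushFun f).comp (continuous_snd.sub continuous_mv)
  exact h2.add h1

theorem push_homotopic (f g : α →o β) (hfg : ∀ a, f a ≤ g a) :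
    (push f).Homotopic (push g) := by
  refine ⟨{ toFun := fun p => ⟨hFun f g (p.1 : ℝ) p.2.1, hFun_mem f g hfg _ p.2.2⟩
            continuous_toFun := ?_
            map_zero_left := ?_
            map_one_left := ?_ }⟩
  · refine Continuous.subtype_mk ?_ _
    exact (continuous_hFun f g).comp
      ((continuous_subtype_val.comp continuous_fst).prodMk
        (continuous_subtype_val.comp continuous_snd))
  · intro x
    have hm : mv 0 x.1 = 0 := by
      funext a
      unfold mv
      rw [max_eq_right (by have := up_nonneg x.2.1 a; linarith), min_eq_left (x.2.1 a)]
      rfl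
    apply Subtype.ext
    show hFun f g ((0 : unitInterval) : ℝ) x.1 = pushFun f x.1
    funext b
    unfold hFun
    simp [hm, pushFun]
  · intro x
    have hm : mv 1 x.1 = x.1 := by
      funext a
      unfold mv
      refine min_eq_right (le_max_of_le_left ?_)
      have := up_add_le x.2.1 a
      have := x.2.2.2
      linarith
    apply Subtype.ext
    show hFun f g ((1 : unitInterval) : ℝ) x.1 = pushFun g x.1
    funext b
    unfold hFun
    simp [hm, pushFun]

/-- A Galois connection induces a homotopy equivalence. -/
theorem equiv_of_galois (f : α →o β) (g : β →o α) (h1 : ∀ a, g (f a) ≤ a)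
    (h2 : ∀ b, b ≤ f (g b)) : Nonempty (ContinuousMap.HomotopyEquiv (real α) (real β)) := by
  refine ⟨⟨push f, push g, ?_, ?_⟩⟩
  · rw [push_comp, ← push_id]
    exact push_homotopic _ _ h1
  · rw [push_comp, ← push_id]
    exact (push_homotopic _ _ h2).symm

/-- the vertex `c` -/
noncomputable def vert (c : α) : real α :=
  ⟨fun a => if a = c then 1 else 0, fun a => by dsimp only; split_ifs <;> norm_num, by
    intro a b ha hb
    have h1 : a = c := by by_contra h; simp [h] at ha
    have h2 : b = c := by by_contra h; simp [h] at hb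
    exact Or.inl (by rw [h1, h2]), by simp⟩

theorem contractible_of_cone (F : α →o α) (c : α) (h1 : ∀ a, F a ≤ a) (h2 : ∀ a, F a ≤ c) :
    ContractibleSpace (real α) := by
  rw [contractible_iff_id_nullhomotopic]
  refine ⟨vert c, ?_⟩
  have e : push (OrderHom.const α c) = ContinuousMap.const (real α) (vert c) := by
    ext x : 2
    funext b
    show pushFun (fun _ => c) x.1 b = if b = c then 1 else 0
    unfold pushFun
    by_cases hb : c = b
    · simp only [hb, if_true]; exact x.2.2.2
    · simp [hb, Ne.symm hb]
  rw [← e, ← push_id]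
  exact (push_homotopic F OrderHom.id h1).symm.trans (push_homotopic F _ h2)

theorem isCompact_real : IsCompact (real α) := by
  have hcl : IsClosed (real α) := by
    have : real α = {x | ∀ a, 0 ≤ x a} ∩ {x | ∀ a b, ¬ (a ≤ b ∨ b ≤ a) → x a * x b = 0} ∩
        {x | ∑ a, x a = 1} := by
      ext x
      unfold real
      simp only [Set.mem_inter_iff, Set.mem_ofPred_eq, mul_eq_zero]
      constructor
      · rintro ⟨h1, h2, h3⟩
        refine ⟨⟨h1, fun a b hab => ?_⟩, h3⟩
        by_contra hc
        push Not at hc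
        exact hab (h2 a b hc.1 hc.2)
      · rintro ⟨⟨h1, h2⟩, h3⟩
        refine ⟨h1, fun a b ha hb => ?_, h3⟩
        by_contra hc
        rcases h2 a b hc with h | h
        · exact ha h
        · exact hb h
    rw [this]
    refine (IsClosed.inter ?_ ?_).inter ?_
    · simp only [Set.ofPred_forall]
      exact isClosed_iInter fun a => isClosed_le continuous_const (continuous_apply a)
    · simp only [Set.ofPred_forall]
      exact isClosed_iInter fun a => isClosed_iInter fun b => isClosed_iInter fun _ =>
        isClosed_eq ((continuous_apply a).mul (continuous_apply b)) continuous_const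
    · exact isClosed_eq (continuous_finsetSum _ fun a _ => continuous_apply a) continuous_const
  refine IsCompact.of_isClosed_subset (isCompact_univ_pi (s := fun _ : α => Set.Icc (0 : ℝ) 1)
    fun _ => isCompact_Icc) hcl ?_
  intro x hx a _
  refine ⟨hx.1 a, ?_⟩
  rw [← hx.2.2]
  exact Finset.single_le_sum (fun b _ => hx.1 b) (Finset.mem_univ a)

end ChainReal

namespace ChainReal

/-- proper nonempty subsets -/
abbrev Q (m : ℕ) := {S : Finset (Fin (m+1)) // S.Nonempty ∧ S ≠ Finset.univ}

theorem exists_avoid {ι : Type*} [Fintype ι] (C : Finset ι → Prop)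
    (hC : ∀ A B, C A → C B → A ≤ B ∨ B ≤ A)
    (S : Finset ι) (hS : S.Nonempty) (hCS : ∀ A, C A → A ⊂ S) : ∃ i ∈ S, ∀ A, C A → i ∉ A := by
  by_cases hne : (Finset.univ.filter C).Nonempty
  · obtain ⟨M, hM, hmax⟩ := Finset.exists_max_image _ Finset.card hne
    have hM' : C M := by simpa using hM
    obtain ⟨i, hiS, hiM⟩ := Finset.exists_of_ssubset (hCS M hM')
    refine ⟨i, hiS, fun A hA hiA => hiM ?_⟩
    rcases hC A M hA hM' with h | h
    · exact h hiA
    · have := Finset.eq_of_subset_of_card_le h (hmax A (by simpa using hA))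
      rw [this]; exact hiA
  · obtain ⟨i, hi⟩ := hS
    refine ⟨i, hi, fun A hA => absurd ⟨A, by simpa using hA⟩ hne⟩

variable {m : ℕ}

/-- coordinates -/
noncomputable def val (x : Q m → ℝ) (i : Fin (m+1)) : ℝ := ∑ S : Q m, if i ∈ S.1 then x S else 0

theorem val_nonneg {x : Q m → ℝ} (hx : ∀ S, 0 ≤ x S) (i) : 0 ≤ val x i := by
  unfold val
  refine Finset.sum_nonneg fun S _ => ?_
  split_ifs
  · exact hx S
  · exact le_rfl

theorem le_val {x : Q m → ℝ} (hx : ∀ S, 0 ≤ x S) {i} {S : Q m} (hi : i ∈ S.1) :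
    x S ≤ val x i := by
  have := Finset.single_le_sum (f := fun S : Q m => if i ∈ S.1 then x S else 0)
    (fun S _ => by split_ifs; exacts [hx S, le_rfl]) (Finset.mem_univ S)
  simpa [hi, val] using this

theorem exists_val_zero {x : Q m → ℝ} (hx : x ∈ real (Q m)) : ∃ i, val x i = 0 := by
  obtain ⟨i, -, hi⟩ := exists_avoid (fun A => ∃ h : A.Nonempty ∧ A ≠ Finset.univ, x ⟨A, h⟩ ≠ 0)
    (by
      rintro A B ⟨hA, hA'⟩ ⟨hB, hB'⟩
      exact hx.2.1 _ _ hA' hB') Finset.univ Finset.univ_nonempty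
    (by
      rintro A ⟨hA, hA'⟩
      exact Finset.ssubset_univ_iff.2 hA.2)
  refine ⟨i, Finset.sum_eq_zero fun S _ => ?_⟩
  split_ifs with h
  · by_contra hc
    exact hi S.1 ⟨S.2, hc⟩ h
  · rfl

theorem exists_val_pos {x : Q m → ℝ} (hx : x ∈ real (Q m)) : ∃ i, 0 < val x i := by
  have : ∃ S, x S ≠ 0 := by
    by_contra hc
    push Not at hc
    have := hx.2.2
    simp [hc] at this
  obtain ⟨S, hS⟩ := this
  obtain ⟨i, hi⟩ := S.2.1
  exact ⟨i, lt_of_lt_of_le (lt_of_le_of_ne (hx.1 S) (Ne.symm hS)) (le_val hx.1 hi)⟩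

theorem val_lt {x : Q m → ℝ} (hx : x ∈ real (Q m)) {S : Q m} (hS : x S ≠ 0) {i j}
    (hi : i ∈ S.1) (hj : j ∉ S.1) : val x j < val x i := by
  unfold val
  refine Finset.sum_lt_sum (fun A _ => ?_) ⟨S, Finset.mem_univ _, ?_⟩
  · by_cases hA : x A = 0
    · simp [hA]
    · by_cases hjA : j ∈ A.1
      · have hiA : i ∈ A.1 := by
          rcases hx.2.1 S A hS hA with h | h
          · exact h hi
          · exact absurd (h hjA) hj
        simp [hjA, hiA]
      · simp only [hjA, if_false]
        split_ifs
        · exact hx.1 A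
        · exact le_rfl
  · simp only [hi, hj, if_true, if_false]
    exact lt_of_le_of_ne (hx.1 S) (Ne.symm hS)

theorem eq_of_val {x x' : Q m → ℝ} (hx : x ∈ real (Q m)) (hx' : x' ∈ real (Q m)) {c : ℝ}
    (hc : 0 < c) (h : ∀ i, val x i = c * val x' i) : x = x' := by
  have cmp : ∀ S S', x S ≠ 0 → x' S' ≠ 0 → S ≤ S' ∨ S' ≤ S := by
    intro S S' hS hS'
    by_contra hn
    push Not at hn
    obtain ⟨i, hi, hi'⟩ := Finset.not_subset.1 hn.1
    obtain ⟨j, hj, hj'⟩ := Finset.not_subset.1 hn.2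
    have h1 := val_lt hx hS hi hj'
    have h2 := val_lt hx' hS' hj hi'
    rw [h i, h j] at h1
    have := lt_of_mul_lt_mul_left h1 hc.le
    linarith
  have cmp2 : ∀ S S', x S ≠ c * x' S → x S' ≠ c * x' S' → S ≤ S' ∨ S' ≤ S := by
    intro S S' hS hS'
    have e : ∀ S, x S ≠ c * x' S → x S ≠ 0 ∨ x' S ≠ 0 := by
      intro S hS
      by_contra hn
      push Not at hn
      apply hS; rw [hn.1, hn.2, mul_zero]
    rcases e S hS with h1 | h1 <;> rcases e S' hS' with h2 | h2
    · exact hx.2.1 _ _ h1 h2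
    · exact cmp _ _ h1 h2
    · exact (cmp _ _ h2 h1).symm
    · exact hx'.2.1 _ _ h1 h2
  have key : ∀ S, x S = c * x' S := by
    by_contra hn
    push Not at hn
    obtain ⟨S0, hS0⟩ := hn
    obtain ⟨S, hS, hmax⟩ := Finset.exists_max_image
      (Finset.univ.filter fun S : Q m => x S ≠ c * x' S) (fun S => S.1.card) ⟨S0, by simpa using hS0⟩
    have hS1 : x S ≠ c * x' S := by simpa using hS
    obtain ⟨i, hi, hav⟩ := exists_avoid
      (fun A => ∃ h : A.Nonempty ∧ A ≠ Finset.univ, x ⟨A, h⟩ ≠ c * x' ⟨A, h⟩ ∧ A ≠ S.1)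
      (by
        rintro A B ⟨hA, hA', _⟩ ⟨hB, hB', _⟩
        exact cmp2 _ _ hA' hB') S.1 S.2.1
      (by
        rintro A ⟨hA, hA', hApp⟩
        rcases cmp2 _ _ hA' hS1 with h | h
        · exact lt_of_le_of_ne h hApp
        · exact absurd (Finset.eq_of_subset_of_card_le h
            (hmax ⟨A, hA⟩ (by simpa using hA'))).symm hApp)
    have h0 : val x i - c * val x' i = 0 := by rw [h i]; ring
    unfold val at h0
    rw [Finset.mul_sum, ← Finset.sum_sub_distrib, Finset.sum_eq_single S] at h0
    · simp only [hi, if_true] at h0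
      exact hS1 (by linarith)
    · intro A _ hA
      by_cases hiA : i ∈ A.1
      · have : x A = c * x' A := by
          by_contra hc
          exact hav A.1 ⟨A.2, hc, fun e => hA (Subtype.ext e)⟩ hiA
        simp [hiA, this]
      · simp [hiA]
    · simp
  have hc1 : c = 1 := by
    have h1 := hx.2.2
    rw [Finset.sum_congr rfl fun S _ => key S, ← Finset.mul_sum, hx'.2.2, mul_one] at h1
    exact h1
  funext S
  rw [key S, hc1, one_mul]

theorem exists_decomp {ι : Type*} [Fintype ι] : ∀ (k : ℕ) (v : ι → ℝ), (∀ i, 0 ≤ v i) →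
    (Finset.univ.filter fun i => v i ≠ 0).card = k →
    ∃ x : Finset ι → ℝ, (∀ S, 0 ≤ x S) ∧ (∀ S, x S ≠ 0 → S.Nonempty ∧ ∀ i ∈ S, v i ≠ 0) ∧
      (∀ S S', x S ≠ 0 → x S' ≠ 0 → S ≤ S' ∨ S' ≤ S) ∧
      ∀ i, v i = ∑ S, if i ∈ S then x S else 0 := by
  intro k
  induction k using Nat.strong_induction_on with
  | _ k ih =>
  intro v hv hk
  set S0 := Finset.univ.filter fun i => v i ≠ 0 with hS0
  by_cases hne : S0.Nonempty
  · obtain ⟨i0, hi0, hmin⟩ := Finset.exists_min_image S0 v hne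
    have hm : ∀ i, i ∈ S0 ↔ v i ≠ 0 := by intro i; simp [hS0]
    have hc : 0 < v i0 := lt_of_le_of_ne (hv i0) (Ne.symm ((hm i0).1 hi0))
    set v' : ι → ℝ := fun i => v i - if i ∈ S0 then v i0 else 0 with hv'
    have hz : ∀ i, v' i ≠ 0 → i ∈ S0 := by
      intro i hi
      by_contra hn
      apply hi
      have : v i = 0 := by by_contra h; exact hn ((hm i).2 h)
      simp [hv', hn, this]
    have hz0 : v' i0 = 0 := by simp [hv', hi0]
    obtain ⟨x, hx0, hx1, hx2, hx3⟩ := ih _ (by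
        rw [← hk]
        refine Finset.card_lt_card (t := S0) ?_
        refine Finset.ssubset_iff_subset_ne.2 ⟨fun i hi => hz i (by simpa using hi), fun e => ?_⟩
        rw [← e] at hi0
        simp [hz0] at hi0) v' (by
        intro i
        simp only [hv']
        split_ifs with h
        · have := hmin i h; linarith
        · have := hv i; linarith) rfl
    have hsub : ∀ S, x S ≠ 0 → S ⊆ S0 := fun S hS i hi => hz i ((hx1 S hS).2 i hi)
    refine ⟨fun S => x S + if S = S0 then v i0 else 0, ?_, ?_, ?_, ?_⟩
    · intro S
      have := hx0 S
      dsimp only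
      split_ifs <;> linarith
    · intro S hS
      by_cases h : S = S0
      · subst h; exact ⟨hne, fun i hi => (hm i).1 hi⟩
      · simp only [h, if_false, add_zero] at hS
        exact ⟨(hx1 S hS).1, fun i hi => (hm i).1 (hsub S hS hi)⟩
    · intro S S' hS hS'
      by_cases h : S = S0 <;> by_cases h' : S' = S0
      · left; rw [h, h']
      · right
        simp only [h', if_false, add_zero] at hS'
        rw [h]; exact hsub _ hS'
      · left
        simp only [h, if_false, add_zero] at hS
        rw [h']; exact hsub _ hS
      · simp only [h, h', if_false, add_zero] at hS hS'
        exact hx2 _ _ hS hS'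
    · intro i
      have e : ∀ S : Finset ι, (if i ∈ S then x S + (if S = S0 then v i0 else 0) else 0) =
          (if i ∈ S then x S else 0) + if S = S0 then (if i ∈ S then v i0 else 0) else 0 := by
        intro S
        split_ifs <;> simp
      rw [Finset.sum_congr rfl fun S _ => e S, Finset.sum_add_distrib, ← hx3 i]
      simp [hv']
  · refine ⟨fun _ => 0, fun _ => le_rfl, by simp, by simp, fun i => ?_⟩
    have : v i = 0 := by
      by_contra h
      exact hne ⟨i, by simpa [hS0] using h⟩
    simp [this]

/-- the map to Euclidean space -/
noncomputable def wMap (x : Q m → ℝ) : EuclideanSpace ℝ (Fin m) :=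
  WithLp.toLp 2 fun j => val x j.castSucc - val x (Fin.last m)

theorem continuous_val (i : Fin (m+1)) : Continuous fun x : Q m → ℝ => val x i := by
  unfold val
  refine continuous_finsetSum _ fun S _ => ?_
  split_ifs
  · exact continuous_apply S
  · exact continuous_const

theorem continuous_wMap : Continuous (wMap (m := m)) := by
  unfold wMap
  refine (PiLp.continuous_toLp 2 _).comp ?_
  exact continuous_pi fun j => (continuous_val _).sub (continuous_val _)

theorem wMap_ne {x : Q m → ℝ} (hx : x ∈ real (Q m)) : wMap x ≠ 0 := by
  intro h
  have h1 : ∀ i, val x i = val x (Fin.last m) := by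
    intro i
    refine Fin.lastCases rfl (fun j => ?_) i
    have := congrArg (fun w : EuclideanSpace ℝ (Fin m) => w j) h
    simp [wMap] at this
    linarith
  obtain ⟨i, hi⟩ := exists_val_zero hx
  obtain ⟨j, hj⟩ := exists_val_pos hx
  rw [h1] at hi hj
  linarith

/-- the map to the sphere -/
noncomputable def toSphere (x : real (Q m)) : Metric.sphere (0 : EuclideanSpace ℝ (Fin m)) 1 :=
  ⟨‖wMap x.1‖⁻¹ • wMap x.1, by
    rw [mem_sphere_zero_iff_norm, norm_smul, norm_inv, norm_norm,
      inv_mul_cancel₀ (norm_ne_zero_iff.2 (wMap_ne x.2))]⟩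

theorem continuous_toSphere : Continuous (toSphere (m := m)) := by
  refine Continuous.subtype_mk ?_ _
  have hw : Continuous fun x : real (Q m) => wMap x.1 := continuous_wMap.comp continuous_subtype_val
  exact (hw.norm.inv₀ fun x => norm_ne_zero_iff.2 (wMap_ne x.2)).smul hw

theorem toSphere_injective : Function.Injective (toSphere (m := m)) := by
  intro x x' h
  have h1 : ‖wMap x.1‖⁻¹ • wMap x.1 = ‖wMap x'.1‖⁻¹ • wMap x'.1 := congrArg Subtype.val h
  have p1 : 0 < ‖wMap x.1‖ := norm_pos_iff.2 (wMap_ne x.2)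
  have p2 : 0 < ‖wMap x'.1‖ := norm_pos_iff.2 (wMap_ne x'.2)
  set c := ‖wMap x.1‖ * ‖wMap x'.1‖⁻¹ with hc
  have hc0 : 0 < c := mul_pos p1 (inv_pos.2 p2)
  have h2 : wMap x.1 = c • wMap x'.1 := by
    rw [hc, mul_smul, ← h1, smul_smul, mul_inv_cancel₀ p1.ne', one_smul]
  have h3 : ∀ i, val x.1 i - val x.1 (Fin.last m) = c * (val x'.1 i - val x'.1 (Fin.last m)) := by
    intro i
    refine Fin.lastCases (by simp) (fun j => ?_) i
    have := congrArg (fun w : EuclideanSpace ℝ (Fin m) => w j) h2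
    simpa [wMap] using this
  have h4 : val x.1 (Fin.last m) = c * val x'.1 (Fin.last m) := by
    obtain ⟨i, hi⟩ := exists_val_zero x.2
    obtain ⟨j, hj⟩ := exists_val_zero x'.2
    have a1 := h3 i
    have a2 := h3 j
    have a3 := mul_nonneg hc0.le (val_nonneg x'.2.1 i)
    have a4 := val_nonneg x.2.1 j
    rw [hi] at a1
    rw [hj] at a2
    apply le_antisymm <;> nlinarith
  exact Subtype.ext (eq_of_val x.2 x'.2 hc0 fun i => by have := h3 i; linarith)

theorem toSphere_surjective : Function.Surjective (toSphere (m := m)) := by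
  intro u
  let ue : Fin (m+1) → ℝ := Fin.snoc (α := fun _ => ℝ) (fun j => u.1 j) 0
  obtain ⟨i0, -, hmin⟩ := Finset.exists_min_image Finset.univ ue Finset.univ_nonempty
  let v : Fin (m+1) → ℝ := fun i => ue i - ue i0
  have hv0 : ∀ i, 0 ≤ v i := fun i => sub_nonneg.2 (hmin i (Finset.mem_univ i))
  obtain ⟨x, hx0, hx1, hx2, hx3⟩ := exists_decomp _ v hv0 rfl
  have hvi0 : v i0 = 0 := sub_self _
  have hQ : ∀ S, x S ≠ 0 → S.Nonempty ∧ S ≠ Finset.univ := by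
    intro S hS
    refine ⟨(hx1 S hS).1, fun e => (hx1 S hS).2 i0 (by rw [e]; exact Finset.mem_univ _) hvi0⟩
  let y : Q m → ℝ := fun S => x S.1
  have hy : ∀ i, val y i = v i := by
    intro i
    have hx4 : v i = ∑ S, if i ∈ S then x S else 0 := by
      convert hx3 i
    rw [hx4]
    unfold val
    rw [← Finset.sum_filter_of_ne (p := fun S => S.Nonempty ∧ S ≠ Finset.univ)
      (f := fun S => if i ∈ S then x S else 0)]
    · exact (Finset.sum_subtype (Finset.univ.filter fun S : Finset (Fin (m+1)) =>
        S.Nonempty ∧ S ≠ Finset.univ) (by simp) (fun S => if i ∈ S then x S else 0)).symm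
    · intro S _ hS
      apply hQ
      intro h
      simp [h] at hS
  have hw : ∀ j : Fin m, v j.castSucc - v (Fin.last m) = u.1 j := by
    intro j
    simp [v, ue]
  have hu1 : ‖u.1‖ = 1 := mem_sphere_zero_iff_norm.1 u.2
  set t : ℝ := ∑ S, y S with ht
  have hy0 : ∀ S, 0 ≤ y S := fun S => hx0 _
  have htpos : 0 < t := by
    refine lt_of_le_of_ne (Finset.sum_nonneg fun S _ => hy0 S) fun h => ?_
    have hz : ∀ S, y S = 0 := by
      intro S
      exact (Finset.sum_eq_zero_iff_of_nonneg fun S _ => hy0 S).1 h.symm S (Finset.mem_univ S)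
    have hvz : ∀ i, v i = 0 := by
      intro i
      rw [← hy i]
      unfold val
      simp [hz]
    have : u.1 = 0 := by
      ext j
      rw [← hw j, hvz, hvz]
      simp
    rw [this] at hu1
    simp at hu1
  have hmem : (fun S => t⁻¹ * y S) ∈ real (Q m) := by
    refine ⟨fun S => mul_nonneg (inv_nonneg.2 htpos.le) (hy0 S), fun S S' hS hS' => ?_, ?_⟩
    · exact hx2 S.1 S'.1 (right_ne_zero_of_mul hS) (right_ne_zero_of_mul hS')
    · rw [← Finset.mul_sum, ← ht, inv_mul_cancel₀ htpos.ne']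
  refine ⟨⟨_, hmem⟩, Subtype.ext ?_⟩
  have hval : ∀ i, val (fun S => t⁻¹ * y S) i = t⁻¹ * v i := by
    intro i
    rw [← hy i]
    unfold val
    rw [Finset.mul_sum]
    refine Finset.sum_congr rfl fun S _ => ?_
    split_ifs <;> simp
  have hW : wMap (fun S => t⁻¹ * y S) = t⁻¹ • u.1 := by
    ext j
    simp only [wMap, hval, PiLp.smul_apply, smul_eq_mul]
    rw [← hw j]; ring
  show ‖wMap (fun S => t⁻¹ * y S)‖⁻¹ • wMap (fun S => t⁻¹ * y S) = u.1
  rw [hW, norm_smul, hu1, mul_one, norm_inv, Real.norm_of_nonneg htpos.le, inv_inv, smul_smul,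
    mul_inv_cancel₀ htpos.ne', one_smul]

theorem boolean_sphere (m : ℕ) :
    Nonempty (real (Q m) ≃ₜ Metric.sphere (0 : EuclideanSpace ℝ (Fin m)) 1) := by
  have : CompactSpace (real (Q m)) := isCompact_iff_compactSpace.1 isCompact_real
  exact ⟨Continuous.homeoOfEquivCompactToT2
    (f := Equiv.ofBijective toSphere ⟨toSphere_injective, toSphere_surjective⟩)
    continuous_toSphere⟩

end ChainReal

namespace NoRetract

open MeasureTheory

variable {E : Type*} [NormedAddCommGroup E] [InnerProductSpace ℝ E] [FiniteDimensional ℝ E]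

theorem det_interp (A : E →L[ℝ] E) (s : Finset ℝ) (hs : Module.finrank ℝ E < s.card) (t : ℝ) :
    (ContinuousLinearMap.id ℝ E + t • A).det =
      ∑ i ∈ s, (Lagrange.basis s id i).eval t * (ContinuousLinearMap.id ℝ E + i • A).det := by
  let b := Module.finBasis ℝ E
  let M := LinearMap.toMatrix b b (A : E →ₗ[ℝ] E)
  let P : Polynomial ℝ := Matrix.det ((Polynomial.X : Polynomial ℝ) • M.map Polynomial.C +
    (1 : Matrix _ _ ℝ).map Polynomial.C)
  have hP : ∀ r : ℝ, (ContinuousLinearMap.id ℝ E + r • A).det = P.eval r := by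
    intro r
    have e1 : (ContinuousLinearMap.id ℝ E + r • A).det =
        LinearMap.det (LinearMap.id + r • (A : E →ₗ[ℝ] E)) := rfl
    rw [e1, ← LinearMap.det_toMatrix b, ← Polynomial.coe_evalRingHom, RingHom.map_det]
    congr 1
    rw [map_add, LinearMap.toMatrix_id, map_smul]
    ext i j
    simp [M, Matrix.one_apply]
    split_ifs <;> simp <;> ring
  have hdeg : P.degree < s.card := by
    refine lt_of_le_of_lt Polynomial.degree_le_natDegree ?_
    have := Polynomial.natDegree_det_X_add_C_le M 1
    rw [Fintype.card_fin] at this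
    exact_mod_cast lt_of_le_of_lt this hs
  rw [hP, Lagrange.eq_interpolate (v := id) (Function.injective_id.injOn) hdeg,
    Lagrange.interpolate_apply, Polynomial.eval_finsetSum]
  refine Finset.sum_congr rfl fun i _ => ?_
  rw [hP, Polynomial.eval_mul, Polynomial.eval_C]
  simp [mul_comm]

theorem det_pos (A : E →L[ℝ] E) {t : ℝ} (ht : 0 ≤ t) (h : t * ‖A‖ < 1) :
    0 < (ContinuousLinearMap.id ℝ E + t • A).det := by
  by_contra hn
  push Not at hn
  have hc : ContinuousOn (fun r : ℝ => (ContinuousLinearMap.id ℝ E + r • A).det) (Set.Icc 0 t) := by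
    refine Continuous.continuousOn ?_
    exact ContinuousLinearMap.continuous_det.comp
      (continuous_const.add (continuous_id.smul continuous_const))
  have h0 : (ContinuousLinearMap.id ℝ E + (0 : ℝ) • A).det = 1 := by
    rw [zero_smul, add_zero]; exact LinearMap.det_id
  obtain ⟨r, ⟨hr0, hrt⟩, hr⟩ := intermediate_value_Icc' ht hc (show (0 : ℝ) ∈ _ from
    ⟨hn, by rw [h0]; exact zero_le_one⟩)
  have hk := LinearMap.bot_lt_ker_of_det_eq_zero
    (f := ((ContinuousLinearMap.id ℝ E + r • A : E →L[ℝ] E) : E →ₗ[ℝ] E)) hr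
  obtain ⟨v, hv, hv0⟩ := (Submodule.ne_bot_iff _).1 hk.ne'
  have h1 : v + r • A v = 0 := hv
  have h2 : v = - (r • A v) := eq_neg_of_add_eq_zero_left h1
  have h3 : ‖v‖ ≤ r * (‖A‖ * ‖v‖) := by
    calc ‖v‖ = ‖r • A v‖ := by conv_lhs => rw [h2, norm_neg]
      _ = r * ‖A v‖ := by rw [norm_smul, Real.norm_of_nonneg hr0]
      _ ≤ _ := mul_le_mul_of_nonneg_left (A.le_opNorm v) hr0
  have hvp : 0 < ‖v‖ := norm_pos_iff.2 hv0
  have h4 : r * ‖A‖ ≤ t * ‖A‖ := mul_le_mul_of_nonneg_right hrt (norm_nonneg _)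
  nlinarith

variable [MeasurableSpace E] [BorelSpace E]

theorem no_smooth [Nontrivial E] (F : E → E) (hF : ContDiff ℝ 1 F) (h1 : ∀ x, ‖F x‖ = 1)
    (h2 : ∀ x, ‖x‖ = 1 → F x = x) : False := by
  let B := Metric.ball (0 : E) 1
  let A : E → (E →L[ℝ] E) := fun x => fderiv ℝ F x - ContinuousLinearMap.id ℝ E
  have hAc : Continuous A := (hF.continuous_fderiv one_ne_zero).sub continuous_const
  obtain ⟨K0, hK0⟩ := (isCompact_closedBall (0 : E) 1).exists_bound_of_continuousOn
    hAc.continuousOn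
  let K := max K0 1
  have hKpos : 0 < K := lt_of_lt_of_le one_pos (le_max_right _ _)
  have hK : ∀ x ∈ Metric.closedBall (0 : E) 1, ‖A x‖ ≤ K := fun x hx =>
    (hK0 x hx).trans (le_max_left _ _)
  let G : E → E := fun x => F x - x
  have hG : ∀ x, HasFDerivAt G (A x) x := fun x =>
    ((hF.differentiable one_ne_zero) x).hasFDerivAt.sub (hasFDerivAt_id x)
  have hGl : ∀ x ∈ Metric.closedBall (0 : E) 1, ∀ y ∈ Metric.closedBall (0 : E) 1,
      ‖G x - G y‖ ≤ K * ‖x - y‖ := by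
    intro x hx y hy
    exact (convex_closedBall (0 : E) 1).norm_image_sub_le_of_norm_hasFDerivWithin_le
      (fun z _ => (hG z).hasFDerivWithinAt) hK hy hx
  let f : ℝ → E → E := fun t x => x + t • G x
  have hfd : ∀ t x, HasFDerivAt (f t) (ContinuousLinearMap.id ℝ E + t • A x) x := fun t x =>
    (hasFDerivAt_id x).add ((hG x).const_smul t)
  have hfinj : ∀ t, 0 ≤ t → t * K < 1 → Set.InjOn (f t) (Metric.closedBall 0 1) := by
    intro t ht htK x hx y hy hxy
    have e : x - y = - (t • (G x - G y)) := by
      have : x + t • G x = y + t • G y := hxy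
      rw [smul_sub]
      rw [sub_eq_iff_eq_add, ← sub_eq_zero]
      rw [← sub_eq_zero] at this
      rw [← this]; abel
    have e2 : ‖x - y‖ ≤ t * (K * ‖x - y‖) := by
      conv_lhs => rw [e, norm_neg, norm_smul, Real.norm_of_nonneg ht]
      exact mul_le_mul_of_nonneg_left (hGl x hx y hy) ht
    by_contra hne
    have : 0 < ‖x - y‖ := norm_pos_iff.2 (sub_ne_zero.2 hne)
    nlinarith
  have himg : ∀ t, 0 ≤ t → t * K < 1 → Set.image (f t) B = B := by
    intro t ht htK
    have ht1 : t < 1 := by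
      have : 1 ≤ K := le_max_right _ _
      nlinarith
    have hsub : Set.image (f t) B ⊆ B := by
      rintro _ ⟨x, hx, rfl⟩
      have hx' : ‖x‖ < 1 := by simpa [B] using hx
      have e : f t x = (1 - t) • x + t • F x := by
        simp only [f, G, smul_sub, sub_smul, one_smul]; abel
      have : ‖f t x‖ < 1 := by
        rw [e]
        calc ‖(1 - t) • x + t • F x‖ ≤ ‖(1 - t) • x‖ + ‖t • F x‖ := norm_add_le _ _
          _ = (1 - t) * ‖x‖ + t := by
            rw [norm_smul, norm_smul, h1, Real.norm_of_nonneg ht,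
              Real.norm_of_nonneg (by linarith), mul_one]
          _ < 1 := by nlinarith
      simpa [B] using this
    refine Set.Subset.antisymm hsub ?_
    have hop : IsOpen (Set.image (f t) B) := by
      rw [isOpen_iff_mem_nhds]
      rintro _ ⟨x, hx, rfl⟩
      have hx' : x ∈ Metric.closedBall (0 : E) 1 := Metric.ball_subset_closedBall hx
      have hdet := det_pos (A x) ht (lt_of_le_of_lt (mul_le_mul_of_nonneg_left (hK x hx') ht) htK)
      have hfs : ContDiff ℝ 1 (f t) := contDiff_id.add (contDiff_const.smul (hF.sub contDiff_id))
      have hst : HasStrictFDerivAt (f t) (ContinuousLinearMap.id ℝ E + t • A x) x :=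
        hfs.contDiffAt.hasStrictFDerivAt' (hfd t x) one_ne_zero
      let e := ContinuousLinearMap.toContinuousLinearEquivOfDetNeZero _ hdet.ne'
      have hst2 : HasStrictFDerivAt (f t) (e : E →L[ℝ] E) x := by
        rw [ContinuousLinearMap.coe_toContinuousLinearEquivOfDetNeZero]; exact hst
      rw [← hst2.map_nhds_eq_of_equiv]
      exact Filter.image_mem_map (Metric.isOpen_ball.mem_nhds hx)
    have hcont : Continuous (f t) := by
      rw [continuous_iff_continuousAt]; exact fun x => (hfd t x).continuousAt
    have hcl : IsClosed (Set.image (f t) (Metric.closedBall 0 1)) :=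
      ((isCompact_closedBall (0 : E) 1).image hcont).isClosed
    have hpc : IsPreconnected B := (convex_ball (0 : E) 1).isPreconnected
    refine hpc.subset_of_closure_inter_subset hop ⟨f t 0, ?_⟩ ?_
    · have h0 : (0 : E) ∈ B := by simp [B]
      exact ⟨hsub ⟨0, h0, rfl⟩, ⟨0, h0, rfl⟩⟩
    · rintro y ⟨hy, hyB⟩
      have : y ∈ Set.image (f t) (Metric.closedBall 0 1) :=
        closure_minimal (Set.image_mono Metric.ball_subset_closedBall) hcl hy
      obtain ⟨x, hx, rfl⟩ := this
      refine ⟨x, ?_, rfl⟩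
      have hx' : ‖x‖ ≤ 1 := by simpa using hx
      rcases hx'.lt_or_eq with h | h
      · simpa [B] using h
      · exfalso
        have e : f t x = x := by simp [f, G, h2 x h]
        rw [e] at hyB
        have : ‖x‖ < 1 := by simpa [B] using hyB
        linarith
  have hvol : ∀ t, 0 ≤ t → t * K < 1 →
      ∫ x in B, (ContinuousLinearMap.id ℝ E + t • A x).det = volume.real B := by
    intro t ht htK
    have e := integral_image_eq_integral_abs_det_fderiv_smul (volume : Measure E)
      (s := B) (f := f t) Metric.isOpen_ball.measurableSet (fun x _ => (hfd t x).hasFDerivWithinAt)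
      ((hfinj t ht htK).mono Metric.ball_subset_closedBall) (fun _ => (1 : ℝ))
    rw [himg t ht htK] at e
    simp only [smul_eq_mul, mul_one, integral_const] at e
    rw [measureReal_restrict_apply_univ] at e
    rw [e]
    refine setIntegral_congr_fun Metric.isOpen_ball.measurableSet fun x hx => ?_
    exact (abs_of_pos (det_pos (A x) ht (lt_of_le_of_lt (mul_le_mul_of_nonneg_left
      (hK x (Metric.ball_subset_closedBall hx)) ht) htK))).symm
  have hintg : ∀ t : ℝ, IntegrableOn (fun x => (ContinuousLinearMap.id ℝ E + t • A x).det) B := by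
    intro t
    have hc : Continuous fun x => (ContinuousLinearMap.id ℝ E + t • A x).det :=
      ContinuousLinearMap.continuous_det.comp (continuous_const.add (hAc.const_smul t))
    exact (hc.continuousOn.integrableOn_compact (isCompact_closedBall (0 : E) 1)).mono_set
      Metric.ball_subset_closedBall
  have hdet1 : ∀ x, (ContinuousLinearMap.id ℝ E + (1 : ℝ) • A x).det = 0 := by
    intro x
    have e : ContinuousLinearMap.id ℝ E + (1 : ℝ) • A x = fderiv ℝ F x := by
      simp [A]
    rw [e]
    by_contra hne
    let e := ContinuousLinearMap.toContinuousLinearEquivOfDetNeZero _ hne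
    have hd : HasFDerivAt F (fderiv ℝ F x) x := ((hF.differentiable one_ne_zero) x).hasFDerivAt
    have hd2 := hd.norm_sq
    have hconst : (fun y => ‖F y‖ ^ 2) = fun _ => (1 : ℝ) := by
      funext y; rw [h1]; norm_num
    have hz := hd2.unique (by rw [hconst]; exact hasFDerivAt_const (1 : ℝ) x)
    have hz2 := congrArg (fun L : E →L[ℝ] ℝ => L (e.symm (F x))) hz
    have he : (fderiv ℝ F x) (e.symm (F x)) = F x := by
      have := e.apply_symm_apply (F x)
      rwa [ContinuousLinearMap.toContinuousLinearEquivOfDetNeZero_apply] at this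
    simp [he, h1] at hz2
  let N := Module.finrank ℝ E + 1
  let s : Finset ℝ := (Finset.range N).image fun k : ℕ => (k : ℝ) / (N * K)
  have hNK : (0 : ℝ) < N * K := mul_pos (by positivity) hKpos
  have hscard : s.card = N := by
    rw [Finset.card_image_of_injective, Finset.card_range]
    intro i j hij
    have : (i : ℝ) = j := by
      have := hij
      dsimp only at this
      rwa [div_left_inj' hNK.ne'] at this
    exact_mod_cast this
  have hs : ∀ i ∈ s, 0 ≤ i ∧ i * K < 1 := by
    intro i hi
    obtain ⟨k, hk, rfl⟩ := Finset.mem_image.1 hi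
    have hk' : (k : ℝ) < N := by exact_mod_cast Finset.mem_range.1 hk
    refine ⟨div_nonneg (Nat.cast_nonneg _) hNK.le, ?_⟩
    rw [div_mul_eq_mul_div, div_lt_one hNK]
    exact mul_lt_mul_of_pos_right hk' hKpos
  have hfin : (0 : ℝ) = volume.real B := by
    calc (0 : ℝ) = ∫ x in B, (ContinuousLinearMap.id ℝ E + (1 : ℝ) • A x).det := by
          simp only [hdet1, integral_zero]
      _ = ∫ x in B, ∑ i ∈ s, (Lagrange.basis s id i).eval 1 *
            (ContinuousLinearMap.id ℝ E + i • A x).det := by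
          congr 1; funext x
          exact det_interp (A x) s (by rw [hscard]; exact Nat.lt_succ_self _) 1
      _ = ∑ i ∈ s, (Lagrange.basis s id i).eval 1 *
            ∫ x in B, (ContinuousLinearMap.id ℝ E + i • A x).det := by
          rw [integral_finsetSum _ fun i _ => (hintg i).const_mul _]
          refine Finset.sum_congr rfl fun i _ => ?_
          rw [integral_const_mul]
      _ = ∑ i ∈ s, (Lagrange.basis s id i).eval 1 * volume.real B := by
          refine Finset.sum_congr rfl fun i hi => ?_
          rw [hvol i (hs i hi).1 (hs i hi).2]
      _ = volume.real B := by
          rw [← Finset.sum_mul, ← Polynomial.eval_finsetSum, Lagrange.sum_basis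
            Function.injective_id.injOn (Finset.card_pos.1 (by rw [hscard]; exact Nat.succ_pos _))]
          simp
  have hpos : 0 < volume.real B :=
    ENNReal.toReal_pos (Metric.measure_ball_pos _ _ one_pos).ne' measure_ball_lt_top.ne
  linarith

open scoped Manifold ContDiff Topology

theorem contDiffAt_unit {x : E} (hx : x ≠ 0) : ContDiffAt ℝ 1 (fun y : E => ‖y‖⁻¹ • y) x :=
  ((contDiffAt_norm ℝ hx).inv (norm_ne_zero_iff.2 hx)).smul contDiffAt_id

theorem norm_unit {x : E} (hx : x ≠ 0) : ‖‖x‖⁻¹ • x‖ = 1 := by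
  rw [norm_smul, norm_inv, norm_norm, inv_mul_cancel₀ (norm_ne_zero_iff.2 hx)]

theorem no_cont [Nontrivial E] (r : E → E) (hr : Continuous r) (h1 : ∀ x, ‖r x‖ = 1)
    (h2 : ∀ x, 1 / 2 ≤ ‖x‖ → r x = ‖x‖⁻¹ • x) : False := by
  let t : E → Set E := fun x => if ‖x‖ < 1 then Metric.ball (r x) (1 / 2) else {‖x‖⁻¹ • x}
  obtain ⟨g, hg⟩ := exists_contMDiffMap_forall_mem_convex_of_local (n := (1 : ℕ∞)) 𝓘(ℝ, E)
    (t := t) (F := E) (by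
      intro x
      simp only [t]
      split_ifs
      · exact convex_ball _ _
      · exact convex_singleton _) (by
      intro x
      by_cases hx : ‖x‖ < 1
      · refine ⟨{y | ‖y‖ < 1} ∩ {y | dist (r x) (r y) < 1 / 2}, ?_, fun _ => r x, ?_, ?_⟩
        · refine Filter.inter_mem ((isOpen_lt continuous_norm continuous_const).mem_nhds hx) ?_
          exact (isOpen_lt (continuous_const.dist hr) continuous_const).mem_nhds (by simp)
        · exact contMDiffOn_const
        · rintro y ⟨hy1, hy2⟩
          have hy1' : ‖y‖ < 1 := hy1
          simp only [t, hy1', if_true]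
          exact hy2
      · refine ⟨{y | 1 / 2 < ‖y‖}, ?_, fun y => ‖y‖⁻¹ • y, ?_, ?_⟩
        · refine (isOpen_lt continuous_const continuous_norm).mem_nhds ?_
          show 1 / 2 < ‖x‖
          linarith
        · rw [contMDiffOn_iff_contDiffOn]
          intro y hy
          have hy' : 1 / 2 < ‖y‖ := hy
          refine (contDiffAt_unit ?_).contDiffWithinAt
          rw [← norm_pos_iff]; linarith
        · intro y hy
          have hy' : 1 / 2 < ‖y‖ := hy
          simp only [t]
          split_ifs
          · rw [h2 y hy'.le]; simp
          · rfl)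
  have hgne : ∀ x, g x ≠ 0 := by
    intro x h0
    have := hg x
    rw [h0] at this
    simp only [t] at this
    split_ifs at this with hx
    · have e : dist 0 (r x) < 1 / 2 := this
      rw [dist_zero_left, h1] at e
      norm_num at e
    · have e : (0 : E) = ‖x‖⁻¹ • x := this
      have hx0 : x ≠ 0 := by
        rw [← norm_pos_iff]; linarith
      have := norm_unit hx0
      rw [← e] at this
      simp at this
  have hgs : ContDiff ℝ 1 g := by
    have := g.contMDiff
    rw [contMDiff_iff_contDiff] at this
    exact this
  refine no_smooth (fun x => ‖g x‖⁻¹ • g x) ?_ (fun x => norm_unit (hgne x)) ?_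
  · rw [contDiff_iff_contDiffAt]
    intro x
    exact (contDiffAt_unit (hgne x)).comp x hgs.contDiffAt
  · intro x hx
    have := hg x
    simp only [t, hx, lt_irrefl, if_false, inv_one, one_smul] at this
    have e : g x = x := this
    rw [e, hx]; simp

theorem sphere_not_contractible (h : ContractibleSpace (Metric.sphere (0 : E) 1)) : False := by
  obtain ⟨p, ⟨H⟩⟩ := contractible_iff_id_nullhomotopic _ |>.1 h
  have hp : ‖p.1‖ = 1 := mem_sphere_zero_iff_norm.1 p.2
  have : Nontrivial E := ⟨p.1, 0, by rw [← norm_pos_iff, hp]; exact one_pos⟩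
  let σ : E → unitInterval := fun x => Set.projIcc 0 1 zero_le_one (2 - 4 * ‖x‖)
  have hσ : Continuous σ :=
    continuous_projIcc.comp (continuous_const.sub (continuous_const.mul continuous_norm))
  let u : E → Metric.sphere (0 : E) 1 := fun x =>
    if hx : x = 0 then p else ⟨‖x‖⁻¹ • x, mem_sphere_zero_iff_norm.2 (norm_unit hx)⟩
  have hu : ∀ x, x ≠ 0 → ContinuousAt u x := by
    intro x hx
    rw [Topology.IsInducing.subtypeVal.continuousAt_iff]
    have e : (fun y : E => ‖y‖⁻¹ • y) =ᶠ[𝓝 x] Subtype.val ∘ u := by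
      filter_upwards [isOpen_ne.mem_nhds hx] with y hy
      have hy' : y ≠ 0 := hy
      simp [u, hy']
    exact (contDiffAt_unit hx).continuousAt.congr e
  refine no_cont (fun x => (H (σ x, u x)).1) ?_ ?_ ?_
  · rw [continuous_iff_continuousAt]
    intro x
    by_cases hx : x = 0
    · have hev : (fun _ => p.1) =ᶠ[𝓝 x] (fun x => (H (σ x, u x)).1) := by
        have : {y : E | ‖y‖ < 1 / 4} ∈ 𝓝 x :=
          (isOpen_lt continuous_norm continuous_const).mem_nhds (by simp [hx])
        filter_upwards [this] with y hy
        have hy' : ‖y‖ < 1 / 4 := hy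
        have e : σ y = 1 := Set.projIcc_of_right_le _ (by linarith)
        rw [e, H.apply_one]; rfl
      exact continuousAt_const.congr hev
    · exact continuous_subtype_val.continuousAt.comp
        (ContinuousAt.comp (f := fun y => (σ y, u y)) (g := H) H.continuous.continuousAt
          (hσ.continuousAt.prodMk (hu x hx)))
  · intro x
    exact mem_sphere_zero_iff_norm.1 (H (σ x, u x)).2
  · intro x hx
    have e : σ x = 0 := Set.projIcc_of_le_left _ (by linarith)
    have hx0 : x ≠ 0 := by rw [← norm_pos_iff]; linarith
    simp only [e, H.apply_zero]
    simp [u, hx0]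

end NoRetract

namespace SDecTree

variable {n : ℕ} {s : ℕ → ℕ}

instance instPO : PartialOrder (SDecTree n s) where
  le := wle
  lt := wlt
  le_refl T y x := le_rfl
  le_trans T U V h1 h2 y x := (h1 y x).trans (h2 y x)
  lt_iff_le_not_ge T U := Iff.rfl
  le_antisymm T U h1 h2 := ext_card fun y x => le_antisymm (h1 y x) (h2 y x)

theorem le_card {T U : SDecTree n s} (h : T ≤ U) (y x : ℕ) : T.card y x ≤ U.card y x := h y x

theorem finite_trees : Finite (SDecTree n s) := by
  let φ : SDecTree n s → ((y : Fin (n+1)) → Fin (n+1) → Fin (s y + 1)) := fun T y x =>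
    ⟨T.card y x, Nat.lt_succ_of_le (T.card_le y x)⟩
  refine Finite.of_injective φ fun T U h => ext_card fun y x => ?_
  by_cases hr : 1 ≤ x ∧ x < y ∧ y ≤ n
  · have := congrFun (congrFun h ⟨y, by omega⟩) ⟨x, by omega⟩
    exact congrArg Fin.val this
  · rw [T.card_out hr, U.card_out hr]

noncomputable instance instFT : Fintype (SDecTree n s) :=
  @Fintype.ofFinite _ finite_trees

/-- the open interval as a poset -/
abbrev Iv (T Z : SDecTree n s) := {U : SDecTree n s // T < U ∧ U < Z}

theorem sum_Iv (T Z : SDecTree n s) (f : SDecTree n s → ℝ)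
    (hf : ∀ U, f U ≠ 0 → T < U ∧ U < Z) : ∑ U : Iv T Z, f U.1 = ∑ᶠ U, f U := by
  rw [finsum_eq_sum_of_fintype, ← Finset.sum_filter_of_ne (p := fun U => T < U ∧ U < Z)
      (f := f) (fun U _ h => hf U h)]
  exact (Finset.sum_subtype (Finset.univ.filter fun U : SDecTree n s =>
        T < U ∧ U < Z) (by simp) f).symm

/-- extension by zero -/
noncomputable def ext0 (T Z : SDecTree n s) (y : Iv T Z → ℝ) : SDecTree n s → ℝ :=
  fun U => if h : T < U ∧ U < Z then y ⟨U, h⟩ else 0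

theorem ext0_ne {T Z : SDecTree n s} {y : Iv T Z → ℝ} {U : SDecTree n s} (h : ext0 T Z y U ≠ 0) :
    ∃ h : T < U ∧ U < Z, y ⟨U, h⟩ ≠ 0 := by
  unfold ext0 at h
  split_ifs at h with h1
  · exact ⟨h1, h⟩
  · exact absurd rfl h

theorem ext0_coe {T Z : SDecTree n s} (y : Iv T Z → ℝ) (U : Iv T Z) : ext0 T Z y U.1 = y U := by
  unfold ext0
  rw [dif_pos U.2]

/-- the order complex is the realization of the open interval -/
noncomputable def ocHomeo (T Z : SDecTree n s) : orderComplex T Z ≃ₜ ChainReal.real (Iv T Z) where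
  toFun f := ⟨fun U => f.1 U.1, fun U => f.2.1 U.1, by
    intro U V hU hV
    by_cases e : U = V
    · exact Or.inl (by rw [e])
    · rcases f.2.2.2.2.1 hU hV (fun h => e (Subtype.ext h)) with h | h
      · exact Or.inl h.1
      · exact Or.inr h.1, by
    rw [sum_Iv T Z f.1 fun U hU => f.2.2.2.1 hU]
    exact f.2.2.2.2.2⟩
  invFun y := ⟨ext0 T Z y.1, by
      intro U
      unfold ext0
      split_ifs
      · exact y.2.1 _
      · exact le_rfl, Set.toFinite _, fun U hU => (ext0_ne hU).1, by
      intro U hU V hV hne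
      obtain ⟨h1, h1'⟩ := ext0_ne hU
      obtain ⟨h2, h2'⟩ := ext0_ne hV
      rcases y.2.2.1 _ _ h1' h2' with h | h
      · exact Or.inl (lt_of_le_of_ne (show U ≤ V from h) hne)
      · exact Or.inr (lt_of_le_of_ne (show V ≤ U from h) (Ne.symm hne)), by
      rw [← sum_Iv T Z _ fun U hU => (ext0_ne hU).1]
      rw [Finset.sum_congr rfl fun U _ => ext0_coe y.1 U]
      exact y.2.2.2⟩
  left_inv f := by
    apply Subtype.ext
    funext U
    show ext0 T Z (fun U => f.1 U.1) U = f.1 U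
    unfold ext0
    split_ifs with h
    · rfl
    · by_contra hc
      exact h (f.2.2.2.1 (Ne.symm hc))
  right_inv y := by
    apply Subtype.ext
    funext U
    exact ext0_coe y.1 U
  continuous_toFun := by
    refine Continuous.subtype_mk (continuous_pi fun U => ?_) _
    exact (continuous_apply U.1).comp continuous_subtype_val
  continuous_invFun := by
    refine Continuous.subtype_mk (continuous_pi fun U => ?_) _
    unfold ext0
    split_ifs with h
    · exact (continuous_apply _).comp continuous_subtype_val
    · exact continuous_const

theorem ascSet_finite (T Z : SDecTree n s) : (ascSet T Z).Finite := by
  refine Set.Finite.subset ((Set.finite_Iic n).prod (Set.finite_Iic n)) ?_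
  rintro ⟨a, b⟩ h
  obtain ⟨h1, h2, h3, -⟩ := h.1
  exact ⟨(show a ≤ n by dsimp only at *; omega), h3⟩

section main

variable {T Z : SDecTree n s} {m : ℕ} (e : Fin (m+1) ≃ ascSet T Z)

/-- set of ascents indexed by `S` -/
def sel (S : Finset (Fin (m+1))) : Set (ℕ × ℕ) := {p | ∃ i ∈ S, (e i).1 = p}

theorem sel_asc (S : Finset (Fin (m+1))) (a b : ℕ) (h : (a, b) ∈ sel e S) : T.TreeAscent a b := by
  obtain ⟨i, -, hi⟩ := h
  have := (e i).2
  rw [hi] at this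
  exact this.1

theorem mem_sel (S : Finset (Fin (m+1))) (i : Fin (m+1)) : (e i).1 ∈ sel e S ↔ i ∈ S := by
  constructor
  · rintro ⟨j, hj, hji⟩
    rw [← e.injective (Subtype.ext hji)]
    exact hj
  · intro h
    exact ⟨i, h, rfl⟩

theorem sel_univ : sel e Finset.univ = ascSet T Z := by
  ext p
  constructor
  · rintro ⟨i, -, rfl⟩
    exact (e i).2
  · intro h
    refine ⟨e.symm ⟨p, h⟩, Finset.mem_univ _, ?_⟩
    rw [Equiv.apply_symm_apply]

/-- join of the selected rotations -/
noncomputable def jn (S : Finset (Fin (m+1))) : SDecTree n s :=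
  (T.isTreeInv_cl_rot (sel_asc e S)).toTree

theorem jn_card (S : Finset (Fin (m+1))) (y x : ℕ) :
    (jn e S).card y x = clInv (T.rot (sel e S)) y x :=
  IsTreeInv.toTree_card _ y x

/-- indices of the ascents that are raised in `U` -/
noncomputable def Af (U : SDecTree n s) : Finset (Fin (m+1)) :=
  Finset.univ.filter fun i => T.card (e i).1.2 (e i).1.1 < U.card (e i).1.2 (e i).1.1

theorem mem_Af {U : SDecTree n s} {i : Fin (m+1)} :
    i ∈ Af e U ↔ T.card (e i).1.2 (e i).1.1 < U.card (e i).1.2 (e i).1.1 := by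
  simp [Af]

theorem rot_le_jn (S : Finset (Fin (m+1))) (y x : ℕ) :
    T.rot (sel e S) y x ≤ (jn e S).card y x := by
  rw [jn_card]
  exact self_le_clInv (fun y x h => T.rot_out (sel_asc e S) y x (by omega)) y x

theorem le_jn (S : Finset (Fin (m+1))) : T ≤ jn e S := fun y x =>
  (T.card_le_rot _ y x).trans (rot_le_jn e S y x)

theorem Af_jn (S : Finset (Fin (m+1))) : Af e (jn e S) = S := by
  ext i
  rw [mem_Af]
  constructor
  · intro h
    by_contra hn
    rw [jn_card] at h
    have := T.cl_rot_of_not_mem (sel_asc e S) (e i).2.1 (fun h' => hn ((mem_sel e S i).1 h'))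
    omega
  · intro h
    have h1 := rot_le_jn e S (e i).1.2 (e i).1.1
    rw [rot_pos (a := (e i).1.1) ((mem_sel e S i).2 h) (Or.inl rfl)] at h1
    exact lt_of_lt_of_le (Nat.lt_succ_self _) h1

theorem jn_le {S : Finset (Fin (m+1))} {U : SDecTree n s} (h1 : T ≤ U) (h2 : S ⊆ Af e U) :
    jn e S ≤ U := by
  intro y x
  rw [jn_card]
  refine clInv_le U.isTreeInv_card.trans ?_ y x
  refine T.rot_le_of_trans (sel_asc e S) U.isTreeInv_card.trans (fun y x => h1 y x) ?_
  rintro a b ⟨i, hi, hab⟩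
  have := (mem_Af e).1 (h2 hi)
  rw [hab] at this
  exact this

theorem Af_mono {U V : SDecTree n s} (h : U ≤ V) : Af e U ⊆ Af e V := by
  intro i hi
  rw [mem_Af] at hi ⊢
  exact lt_of_lt_of_le hi (le_card h _ _)

theorem Af_Z : Af e Z = Finset.univ := by
  ext i
  simp only [mem_Af, Finset.mem_univ, iff_true]
  exact (e i).2.2

theorem Af_nonempty {U : SDecTree n s} (h1 : T < U) (h2 : U ≤ Z) : (Af e U).Nonempty := by
  obtain ⟨a, b, hA, hc⟩ := exists_ascent h1
  refine ⟨e.symm ⟨(a, b), hA, lt_of_lt_of_le hc (le_card h2 b a)⟩, ?_⟩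
  rw [mem_Af, Equiv.apply_symm_apply]
  exact hc

theorem Af_T : Af e T = ∅ := by
  ext i
  simp [mem_Af]

theorem lt_jn {S : Finset (Fin (m+1))} (hS : S.Nonempty) : T < jn e S := by
  refine lt_of_le_of_ne (le_jn e S) fun h => ?_
  have := Af_jn e S
  rw [← h, Af_T] at this
  rw [← this] at hS
  exact Finset.not_nonempty_empty hS

theorem jn_le_Z (hlt : T < Z) (S : Finset (Fin (m+1))) : jn e S ≤ Z :=
  jn_le e hlt.le (by rw [Af_Z]; exact Finset.subset_univ _)

theorem cond_iff : (∀ y x, 1 ≤ x → x < y → y ≤ n → Z.card y x = tcInv (ascSum n s T Z) y x) ↔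
    jn e Finset.univ = Z := by
  have h : ∀ y x, tcInv (ascSum n s T Z) y x = (jn e Finset.univ).card y x := by
    intro y x
    rw [jn_card, ascSum_eq, sel_univ, tcInv_eq]
    intro y x h
    have := T.rot_out (sel_asc e Finset.univ) y x (by omega)
    rwa [sel_univ] at this
  constructor
  · intro hc
    refine ext_card fun y x => ?_
    by_cases hr : 1 ≤ x ∧ x < y ∧ y ≤ n
    · rw [hc y x hr.1 hr.2.1 hr.2.2, h]
    · rw [card_out _ hr, card_out _ hr]
  · intro hc y x _ _ _
    rw [h, hc]

theorem sphere_case (hlt : T < Z) (hc : jn e Finset.univ = Z) :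
    Nonempty (ContinuousMap.HomotopyEquiv (orderComplex T Z)
      (Metric.sphere (0 : EuclideanSpace ℝ (Fin m)) 1)) := by
  let f : Iv T Z →o ChainReal.Q m :=
    { toFun := fun U => ⟨Af e U.1, Af_nonempty e U.2.1 U.2.2.le, fun h => by
        have h1 := jn_le e U.2.1.le (S := Finset.univ) h.ge
        rw [hc] at h1
        exact absurd U.2.2 h1.not_gt⟩
      monotone' := fun U V h => Af_mono e h }
  let g : ChainReal.Q m →o Iv T Z :=
    { toFun := fun S => ⟨jn e S.1, lt_jn e S.2.1, lt_of_le_of_ne (jn_le_Z e hlt _) fun h => by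
        have h1 := Af_jn e S.1
        rw [h, Af_Z] at h1
        exact S.2.2 h1.symm⟩
      monotone' := fun S S' h => by
        refine jn_le e (le_jn e S'.1) ?_
        rw [Af_jn]; exact h }
  obtain ⟨h1⟩ := ChainReal.equiv_of_galois f g
    (fun U => jn_le e U.2.1.le (Finset.Subset.refl _))
    (fun S => by
      show S.1 ⊆ Af e (jn e S.1)
      rw [Af_jn])
  obtain ⟨h2⟩ := ChainReal.boolean_sphere m
  exact ⟨((ocHomeo T Z).toHomotopyEquiv.trans h1).trans h2.toHomotopyEquiv⟩

theorem cone_case (hlt : T < Z) (hc : jn e Finset.univ ≠ Z) :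
    ContractibleSpace (orderComplex T Z) := by
  have hz : jn e Finset.univ < Z := lt_of_le_of_ne (jn_le_Z e hlt _) hc
  have hF : ∀ U : Iv T Z, jn e (Af e U.1) ≤ U.1 := fun U =>
    jn_le e U.2.1.le (Finset.Subset.refl _)
  let F : Iv T Z →o Iv T Z :=
    { toFun := fun U => ⟨jn e (Af e U.1), lt_jn e (Af_nonempty e U.2.1 U.2.2.le),
        lt_of_le_of_lt (hF U) U.2.2⟩
      monotone' := fun U V h => by
        refine jn_le e (le_jn e _) ?_
        rw [Af_jn]; exact Af_mono e h }
  have h1 := ChainReal.contractible_of_cone F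
    ⟨jn e Finset.univ, lt_jn e Finset.univ_nonempty, hz⟩ hF
    (fun U => by
      refine jn_le e (le_jn e _) ?_
      rw [Af_jn]; exact Finset.subset_univ _)
  exact (ocHomeo T Z).contractibleSpace

end main

theorem exists_index {T Z : SDecTree n s} (hlt : T < Z) :
    ∃ m, (ascSet T Z).ncard = m + 1 ∧ Nonempty (Fin (m+1) ≃ ascSet T Z) := by
  have : Finite (ascSet T Z) := (ascSet_finite T Z).to_subtype
  obtain ⟨a, b, hA, hc⟩ := exists_ascent hlt
  have hpos : 0 < (ascSet T Z).ncard :=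
    (Set.ncard_pos (ascSet_finite T Z)).2 ⟨(a, b), hA, hc⟩
  refine ⟨(ascSet T Z).ncard - 1, by omega, ⟨?_⟩⟩
  refine (Finite.equivFinOfCardEq ?_).symm
  rw [Nat.card_coe_set_eq]; omega

end SDecTree

/-- the order complex of the open interval `(T,Z)` is homotopy equivalent
to a sphere iff `inv Z = (inv T + A_T(a₁,b₁) + ⋯ + A_T(a_l,b_l))^tc`, in which case it
is homotopy equivalent to a sphere of dimension `l - 2` (realized as the unit sphere of
`ℝ^(l-1)`), where `l` is the number of tree ascents `(a,b)` of `T` with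
`(b,a) ∈ inv Z − inv T`. -/
theorem count_the_spheres (n : ℕ) (s : ℕ → ℕ) (T Z : SDecTree n s)
    (hlt : SDecTree.wlt T Z) :
    ((∃ d : ℕ, Nonempty (ContinuousMap.HomotopyEquiv
        ↥(SDecTree.orderComplex T Z)
        ↥(Metric.sphere (0 : EuclideanSpace ℝ (Fin d)) 1))) ↔
      (∀ y x, 1 ≤ x → x < y → y ≤ n → Z.card y x = tcInv (ascSum n s T Z) y x)) ∧
    ((∀ y x, 1 ≤ x → x < y → y ≤ n → Z.card y x = tcInv (ascSum n s T Z) y x) →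
      Nonempty (ContinuousMap.HomotopyEquiv
        ↥(SDecTree.orderComplex T Z)
        ↥(Metric.sphere (0 : EuclideanSpace ℝ
          (Fin ({p : ℕ × ℕ | T.TreeAscent p.1 p.2 ∧
            T.card p.2 p.1 < Z.card p.2 p.1}.ncard - 1))) 1))) := by
  obtain ⟨m, hm, ⟨e⟩⟩ := SDecTree.exists_index (T := T) (Z := Z) hlt
  have hm' : {p : ℕ × ℕ | T.TreeAscent p.1 p.2 ∧
      T.card p.2 p.1 < Z.card p.2 p.1}.ncard - 1 = m := by
    have : {p : ℕ × ℕ | T.TreeAscent p.1 p.2 ∧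
      T.card p.2 p.1 < Z.card p.2 p.1}.ncard = m + 1 := hm
    omega
  rw [hm', SDecTree.cond_iff e]
  refine ⟨⟨?_, fun hc => ⟨m, SDecTree.sphere_case e hlt hc⟩⟩, SDecTree.sphere_case e hlt⟩
  rintro ⟨d, ⟨h⟩⟩
  by_contra hc
  have := SDecTree.cone_case e hlt hc
  exact NoRetract.sphere_not_contractible h.symm.contractibleSpace
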